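/- arXiv:2108.06992 — 6 statements merged into one kernel-verified Lean document; each statement's English description precedes it below -/
import Mathlib

section
/- Let a ∈ A be an axis of Jordan type (λ,δ). Then for every y ∈ A, the element y·a lies in the subspace F·a + F·(a·y). -/
/-! Common definitions: eigenspaces of left/right multiplication, axes, Jordan axes,
in a not-necessarily-associative, not-necessarily-commutative, not-necessarily-unital
algebra `A` over a field `F`. -/

variable (F : Type*) [Field F]
variable (A : Type*) [NonUnitalNonAssocRing A] [Module F A]
  [SMulCommClass F A A] [IsScalarTower F A A]

/-- `leftEig F A a l = A_l(L_a) = {v : A | a * v = l • v}`, as a submodule of `A`. -/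
def leftEig (a : A) (l : F) : Submodule F A where
  carrier := {v | a * v = l • v}
  add_mem' := by
    intro x y hx hy
    simp only [Set.mem_setOf_eq] at *
    rw [mul_add, hx, hy, smul_add]
  zero_mem' := by simp
  smul_mem' := by
    intro c x hx
    simp only [Set.mem_setOf_eq] at *
    rw [mul_smul_comm, hx, smul_comm]

/-- `rightEig F A a l = A_l(R_a) = {v : A | v * a = l • v}`, as a submodule of `A`. -/
def rightEig (a : A) (l : F) : Submodule F A where
  carrier := {v | v * a = l • v}
  add_mem' := by
    intro x y hx hy
    simp only [Set.mem_setOf_eq] at *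
    rw [add_mul, hx, hy, smul_add]
  zero_mem' := by simp
  smul_mem' := by
    intro c x hx
    simp only [Set.mem_setOf_eq] at *
    rw [smul_mul_assoc, hx, smul_comm]

/-- `eig2 F A a l d = A_{l,d}(a) = A_l(L_a) ⊓ A_d(R_a)`. -/
def eig2 (a : A) (l d : F) : Submodule F A :=
  leftEig F A a l ⊓ rightEig F A a d

/-- `a` is a left axis of type `l` (with `l ∉ {0,1}`):  an absolutely primitive idempotent
whose left multiplication operator satisfies `(L_a - l)(L_a - 1)L_a = 0`, such that the
eigenspace decomposition `A = A_0(L_a) ⊕ A_1(L_a) ⊕ A_l(L_a)` is a ℤ/2-grading with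
plus part `A_0(L_a) ⊕ A_1(L_a)` and minus part `A_l(L_a)`. -/
structure IsLeftAxis (l : F) (a : A) : Prop where
  l_ne_zero : l ≠ 0
  l_ne_one : l ≠ 1
  idem : a * a = a
  prim : leftEig F A a 1 = Submodule.span F {a}
  cube : ∀ v : A, a * (a * (a * v)) - a * (a * v) - l • (a * (a * v)) + l • (a * v) = 0
  decomp : leftEig F A a 0 ⊔ leftEig F A a 1 ⊔ leftEig F A a l = ⊤
  fusePP : ∀ x ∈ leftEig F A a 0 ⊔ leftEig F A a 1, ∀ y ∈ leftEig F A a 0 ⊔ leftEig F A a 1,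
      x * y ∈ leftEig F A a 0 ⊔ leftEig F A a 1
  fusePM : ∀ x ∈ leftEig F A a 0 ⊔ leftEig F A a 1, ∀ y ∈ leftEig F A a l,
      x * y ∈ leftEig F A a l
  fuseMP : ∀ x ∈ leftEig F A a l, ∀ y ∈ leftEig F A a 0 ⊔ leftEig F A a 1,
      x * y ∈ leftEig F A a l
  fuseMM : ∀ x ∈ leftEig F A a l, ∀ y ∈ leftEig F A a l,
      x * y ∈ leftEig F A a 0 ⊔ leftEig F A a 1

/-- `a` is a right axis of type `d`: the symmetric notion with `R_a` in place of `L_a`. -/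
structure IsRightAxis (d : F) (a : A) : Prop where
  d_ne_zero : d ≠ 0
  d_ne_one : d ≠ 1
  idem : a * a = a
  prim : rightEig F A a 1 = Submodule.span F {a}
  cube : ∀ v : A, v * a * a * a - v * a * a - d • (v * a * a) + d • (v * a) = 0
  decomp : rightEig F A a 0 ⊔ rightEig F A a 1 ⊔ rightEig F A a d = ⊤
  fusePP : ∀ x ∈ rightEig F A a 0 ⊔ rightEig F A a 1, ∀ y ∈ rightEig F A a 0 ⊔ rightEig F A a 1,
      x * y ∈ rightEig F A a 0 ⊔ rightEig F A a 1
  fusePM : ∀ x ∈ rightEig F A a 0 ⊔ rightEig F A a 1, ∀ y ∈ rightEig F A a d,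
      x * y ∈ rightEig F A a d
  fuseMP : ∀ x ∈ rightEig F A a d, ∀ y ∈ rightEig F A a 0 ⊔ rightEig F A a 1,
      x * y ∈ rightEig F A a d
  fuseMM : ∀ x ∈ rightEig F A a d, ∀ y ∈ rightEig F A a d,
      x * y ∈ rightEig F A a 0 ⊔ rightEig F A a 1

/-- `a` is a (two-sided) axis of type `(l, d)`. -/
structure IsAxis (l d : F) (a : A) : Prop where
  toLeft : IsLeftAxis F A l a
  toRight : IsRightAxis F A d a
  comm : ∀ v : A, a * (v * a) = (a * v) * a

/-- `a` is an axis of Jordan type `(l, d)`: an axis of type `(l, d)` with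
`A_{l,0}(a) = A_{0,d}(a) = 0`, so that `A = F·a ⊕ A_{0,0}(a) ⊕ A_{l,d}(a)`. -/
structure IsJordanAxis (l d : F) (a : A) extends IsAxis F A l d a : Prop where
  j_left : eig2 F A a l 0 = ⊥
  j_right : eig2 F A a 0 d = ⊥

variable {F A} in
theorem mem_leftEig {a v : A} {l : F} : v ∈ leftEig F A a l ↔ a * v = l • v := Iff.rfl

variable {F A} in
theorem mem_rightEig {a v : A} {l : F} : v ∈ rightEig F A a l ↔ v * a = l • v := Iff.rfl

variable {F A} in
/-- An eigenvector of `L_a` for an eigenvalue other than `1` that lies in `A_1(R_a)` vanishes. -/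
theorem IsAxis.eq_zero_of_mul_right_eq {l d m : F} {a v : A} (ha : IsAxis F A l d a)
    (hm : m ≠ 1) (hl : a * v = m • v) (hr : v * a = v) : v = 0 := by
  have hv : v ∈ rightEig F A a 1 := mem_rightEig.2 (by rw [hr, one_smul])
  rw [ha.toRight.prim, Submodule.mem_span_singleton] at hv
  obtain ⟨c, rfl⟩ := hv
  rw [mul_smul_comm, ha.toLeft.idem] at hl
  have h : (1 - m) • (c • a) = 0 := by rw [sub_smul, one_smul, ← hl, sub_self]
  exact (smul_eq_zero.1 h).resolve_left (sub_ne_zero.2 hm.symm)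

variable {F A} in
/-- `A_0(L_a)` is annihilated by `R_a` for an axis `a` of Jordan type. -/
theorem IsJordanAxis.mul_right_of_mul_left_eq_zero {l d : F} {a p : A}
    (ha : IsJordanAxis F A l d a) (hp : a * p = 0) : p * a = 0 := by
  have h₁ : a * (p * a) = 0 := by rw [ha.comm, hp, zero_mul]
  have h₂ : a * (p * a * a) = 0 := by rw [ha.comm, h₁, zero_mul]
  have hz : p * a * a - p * a ∈ eig2 F A a 0 d := by
    refine ⟨mem_leftEig.2 ?_, mem_rightEig.2 ?_⟩
    · rw [mul_sub, h₁, h₂, sub_self, zero_smul]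
    · have h := ha.toRight.cube p
      rw [sub_mul, smul_sub, ← sub_eq_zero, ← h]
      abel
  rw [ha.j_right, Submodule.mem_bot, sub_eq_zero] at hz
  exact ha.toIsAxis.eq_zero_of_mul_right_eq zero_ne_one (by rw [h₁, zero_smul]) hz

variable {F A} in
/-- `A_l(L_a)` is contained in `A_d(R_a)` for an axis `a` of Jordan type `(l, d)`. -/
theorem IsJordanAxis.mul_right_of_mul_left_eq_smul {l d : F} {a q : A}
    (ha : IsJordanAxis F A l d a) (hq : a * q = l • q) : q * a = d • q := by
  have h₁ : a * (q * a) = l • (q * a) := by rw [ha.comm, hq, smul_mul_assoc]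
  have h₂ : a * (q * a * a) = l • (q * a * a) := by rw [ha.comm, h₁, smul_mul_assoc]
  have hz : q * a * a - q * a - d • (q * a) + d • q ∈ eig2 F A a l 0 := by
    refine ⟨?_, mem_rightEig.2 ?_⟩
    · have m₁ : q * a ∈ leftEig F A a l := h₁
      have m₂ : q * a * a ∈ leftEig F A a l := h₂
      have m₀ : q ∈ leftEig F A a l := hq
      exact add_mem (sub_mem (sub_mem m₂ m₁) (Submodule.smul_mem _ _ m₁))
        (Submodule.smul_mem _ _ m₀)
    · rw [add_mul, sub_mul, sub_mul, smul_mul_assoc, smul_mul_assoc, ha.toRight.cube, zero_smul]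
  rw [ha.j_left, Submodule.mem_bot] at hz
  refine sub_eq_zero.1 (ha.toIsAxis.eq_zero_of_mul_right_eq ha.toLeft.l_ne_one ?_ ?_)
  · rw [mul_sub, h₁, mul_smul_comm, hq, smul_sub, smul_comm]
  · rw [sub_mul, smul_mul_assoc, ← sub_eq_zero, ← hz]
    abel

/-- If `a` is an axis of Jordan type `(l, d)`, then for every `y ∈ A`,
`y * a ∈ F·a + F·(a * y)`. -/
theorem jordan_axis_mul_right_mem (hchar : (2 : F) ≠ 0) (l d : F) (a : A)
    (ha : IsJordanAxis F A l d a) (y : A) :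
    ∃ c₁ c₂ : F, y * a = c₁ • a + c₂ • (a * y) := by
  have hy : y ∈ leftEig F A a 0 ⊔ leftEig F A a 1 ⊔ leftEig F A a l := by
    rw [ha.toLeft.decomp]
    exact Submodule.mem_top
  obtain ⟨x, hx, q, hq, rfl⟩ := Submodule.mem_sup.1 hy
  obtain ⟨p, hp, z, hz, rfl⟩ := Submodule.mem_sup.1 hx
  rw [ha.toLeft.prim, Submodule.mem_span_singleton] at hz
  obtain ⟨c, rfl⟩ := hz
  rw [mem_leftEig] at hq
  rw [mem_leftEig, zero_smul] at hp
  refine ⟨c - d / l * c, d / l, ?_⟩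
  simp only [add_mul, mul_add, smul_mul_assoc, mul_smul_comm, ha.toLeft.idem, hp, hq,
    ha.mul_right_of_mul_left_eq_zero hp, ha.mul_right_of_mul_left_eq_smul hq, zero_add,
    smul_add, smul_smul, sub_smul, div_mul_cancel₀ d ha.toLeft.l_ne_zero]
  abel
end

section
/- Suppose dim_F A = 2 and A is generated as an F-algebra by two axes a of type (λ,δ) and b of type (λ',δ'). Then either A is commutative, or else λ' = λ, δ' = δ, λ + δ = 1, λ ≠ δ, a·b = δ·a + λ·b and b·a = λ·a + δ·b. In either case, A is flexible. -/
/-! Common definitions: eigenspaces of left/right multiplication, axes, Jordan axes,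
in a not-necessarily-associative, not-necessarily-commutative, not-necessarily-unital
algebra `A` over a field `F`. -/

variable (F : Type*) [Field F]
variable (A : Type*) [NonUnitalNonAssocRing A] [Module F A]
  [SMulCommClass F A A] [IsScalarTower F A A]

section
variable {F A}

/-- In a two-dimensional algebra, a left axis has a nonzero left eigenvector of eigenvalue
`0` or `l`. -/
theorem IsLeftAxis.exists_eigenvector {l : F} {a : A} (ha : IsLeftAxis F A l a)
    (hdim : Module.finrank F A = 2) :
    ∃ (v : A) (m : F), v ≠ 0 ∧ a * v = m • v ∧ (m = 0 ∨ m = l) := by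
  by_contra! h
  have key : ∀ m : F, m = 0 ∨ m = l → leftEig F A a m = ⊥ := by
    intro m hm
    rw [eq_bot_iff]
    intro x hx
    by_contra hx0
    have := h x m hx0 hx
    tauto
  have htop := ha.decomp
  rw [key 0 (Or.inl rfl), key l (Or.inr rfl), ha.prim, bot_sup_eq, sup_bot_eq] at htop
  have hle := finrank_span_le_card (R := F) ({a} : Set A)
  rw [htop, finrank_top, hdim] at hle
  simp at hle

/-- A two-dimensional algebra containing an axis `a` has a basis consisting of `a` and a common
eigenvector of the left and right multiplications by `a`. -/
theorem IsAxis.exists_eigenbasis {l d : F} {a : A} (ha : IsAxis F A l d a) (ha0 : a ≠ 0)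
    (hdim : Module.finrank F A = 2) :
    ∃ (v : A) (m n : F), (∀ x y : F, x • a + y • v = 0 → x = 0 ∧ y = 0) ∧
      (∀ z : A, ∃ x y : F, z = x • a + y • v) ∧ a * v = m • v ∧ v * a = n • v ∧
      (m = 0 ∨ m = l) ∧ (n = 0 ∨ n = d) ∧ (m = l ∨ n = d → ∃ c : F, v * v = c • a) := by
  obtain ⟨hL, hR, hcomm⟩ := ha
  have haa := hL.idem
  obtain ⟨v, m, hv0, hav, hm⟩ := hL.exists_eigenvector hdim
  have hm1 : m ≠ 1 := by
    rcases hm with rfl | rfl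
    exacts [zero_ne_one, hL.l_ne_one]
  have hind : ∀ x y : F, x • a + y • v = 0 → x = 0 ∧ y = 0 := by
    intro x y h
    have h2 : a * (x • a + y • v) = 0 := by rw [h, mul_zero]
    rw [mul_add, mul_smul_comm, mul_smul_comm, haa, hav] at h2
    have h3 : (y * (1 - m)) • v = 0 := by
      linear_combination (norm := module) h - h2
    have hy : y = 0 := by
      simpa [hv0, sub_eq_zero, hm1.symm] using h3
    subst hy
    simpa [ha0] using h
  have hspan : ∀ z : A, ∃ x y : F, z = x • a + y • v := by
    have hli : LinearIndependent F ![a, v] := LinearIndependent.pair_iff.2 hind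
    have htop := hli.span_eq_top_of_card_eq_finrank (by simp [hdim])
    intro z
    have hz : z ∈ Submodule.span F (Set.range ![a, v]) := htop ▸ Submodule.mem_top
    simp only [Matrix.range_cons, Matrix.range_empty, Set.union_empty, Set.singleton_union] at hz
    obtain ⟨x, y, h⟩ := Submodule.mem_span_pair.1 hz
    exact ⟨x, y, h.symm⟩
  obtain ⟨x, n, hva⟩ := hspan (v * a)
  have hx : x = 0 := by
    have h := hcomm v
    rw [hav, smul_mul_assoc, hva, mul_add, mul_smul_comm, mul_smul_comm, haa, hav] at h
    have h' : (x * (1 - m)) • a + (0 : F) • v = 0 := by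
      linear_combination (norm := module) h
    simpa [sub_eq_zero, hm1.symm] using (hind _ _ h').1
  subst hx
  rw [zero_smul, zero_add] at hva
  have hn1 : n ≠ 1 := by
    rintro rfl
    have hmem : v ∈ rightEig F A a 1 := hva
    rw [hR.prim, Submodule.mem_span_singleton] at hmem
    obtain ⟨c, hc⟩ := hmem
    have h := hind c (-1) (by rw [hc]; simp)
    simp at h
  have hn : n = 0 ∨ n = d := by
    have h := hR.cube v
    simp only [hva, smul_mul_assoc] at h
    have h' : (n * (n - 1) * (n - d)) • v = 0 := by
      linear_combination (norm := module) h
    simpa [hv0, sub_eq_zero, hn1] using h'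
  refine ⟨v, m, n, hind, hspan, hav, hva, hm, hn, ?_⟩
  obtain ⟨s, t, hvv⟩ := hspan (v * v)
  suffices h : m = l ∨ n = d → t = 0 by
    intro hmn
    exact ⟨s, by rw [hvv, h hmn, zero_smul, add_zero]⟩
  rintro (rfl | rfl)
  · have h := hL.fuseMM v hav v hav
    rw [hL.prim, Submodule.mem_sup] at h
    obtain ⟨z, hz, w, hw, hzw⟩ := h
    obtain ⟨c, rfl⟩ := Submodule.mem_span_singleton.1 hw
    have hz' : a * z = (0 : F) • z := hz
    have h2 : a * (z + c • a) = a * (s • a + t • v) := by rw [hzw, hvv]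
    simp only [mul_add, mul_smul_comm, haa, hav, hz'] at h2
    have h3 : (s - c) • a + (t * m) • v = 0 := by linear_combination (norm := module) -h2
    simpa [hL.l_ne_zero] using (hind _ _ h3).2
  · have h := hR.fuseMM v hva v hva
    rw [hR.prim, Submodule.mem_sup] at h
    obtain ⟨z, hz, w, hw, hzw⟩ := h
    obtain ⟨c, rfl⟩ := Submodule.mem_span_singleton.1 hw
    have hz' : z * a = (0 : F) • z := hz
    have h2 : (z + c • a) * a = (s • a + t • v) * a := by rw [hzw, hvv]
    simp only [add_mul, smul_mul_assoc, haa, hva, hz'] at h2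
    have h3 : (s - c) • a + (t * n) • v = 0 := by linear_combination (norm := module) -h2
    simpa [hR.d_ne_zero] using (hind _ _ h3).2

/-- An algebra generated by an idempotent `a` and a multiple of `a` is spanned by `a`. -/
theorem exists_smul_eq_of_adjoin_pair_eq_top {a b : A} (haa : a * a = a) {c : F}
    (hb : b = c • a) (hgen : NonUnitalAlgebra.adjoin F {a, b} = ⊤) (z : A) :
    ∃ x : F, z = x • a := by
  have hz : z ∈ NonUnitalAlgebra.adjoin F {a, b} := hgen ▸ NonUnitalAlgebra.mem_top
  induction hz using NonUnitalAlgebra.adjoin_induction with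
  | mem x hx =>
    rcases hx with rfl | rfl
    exacts [⟨1, (one_smul _ _).symm⟩, ⟨c, hb⟩]
  | add x y _ _ hx hy =>
    obtain ⟨x, rfl⟩ := hx
    obtain ⟨y, rfl⟩ := hy
    exact ⟨x + y, (add_smul _ _ _).symm⟩
  | zero => exact ⟨0, (zero_smul _ _).symm⟩
  | mul x y _ _ hx hy =>
    obtain ⟨x, rfl⟩ := hx
    obtain ⟨y, rfl⟩ := hy
    exact ⟨x * y, by rw [smul_mul_smul_comm, haa]⟩
  | smul r x _ hx =>
    obtain ⟨x, rfl⟩ := hx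
    exact ⟨r * x, smul_smul _ _ _⟩

end

/-- If `dim_F A = 2` and `A` is generated by two axes `a` of type `(l, d)` and
`b` of type `(l', d')`, then either `A` is commutative, or `l' = l`, `d' = d`, `l + d = 1`,
`l ≠ d`, `a*b = d•a + l•b` and `b*a = l•a + d•b`; in either case `A` is flexible. -/
theorem dim_two_two_generated (hchar : (2 : F) ≠ 0) (l d l' d' : F) (a b : A)
    (ha : IsAxis F A l d a) (hb : IsAxis F A l' d' b)
    (hdim : Module.finrank F A = 2)
    (hgen : NonUnitalAlgebra.adjoin F {a, b} = ⊤) :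
    ((∀ x y : A, x * y = y * x) ∨
      (l' = l ∧ d' = d ∧ l + d = 1 ∧ l ≠ d ∧
        a * b = d • a + l • b ∧ b * a = l • a + d • b)) ∧
    (∀ x y : A, (x * y) * x = x * (y * x)) := by
  have haa := ha.toLeft.idem
  have hbb := hb.toLeft.idem
  have hline : ∀ c : F, b ≠ c • a := by
    intro c hc
    have h := finrank_le_one a fun z =>
      (exists_smul_eq_of_adjoin_pair_eq_top haa hc hgen z).imp fun _ h => h.symm
    omega
  have ha0 : a ≠ 0 := by
    rintro rfl
    have h := finrank_le_one b fun z =>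
      (exists_smul_eq_of_adjoin_pair_eq_top hbb (zero_smul F b).symm
        (Set.pair_comm 0 b ▸ hgen) z).imp fun _ h => h.symm
    omega
  obtain ⟨v, m, n, hind, hspan, hav, hva, hm, hn, hsq⟩ := ha.exists_eigenbasis ha0 hdim
  by_cases hmn : m = n
  · subst hmn
    have hc : ∀ x y : A, x * y = y * x := by
      intro x y
      obtain ⟨p, q, rfl⟩ := hspan x
      obtain ⟨r, s, rfl⟩ := hspan y
      simp only [mul_add, add_mul, mul_smul_comm, smul_mul_assoc, haa, hav, hva]
      module
    exact ⟨Or.inl hc, fun x y => by rw [hc y x, hc (x * y) x]⟩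
  obtain ⟨c, hvv⟩ := hsq (by grind)
  obtain ⟨α, β, rfl⟩ := hspan b
  have hβ : β ≠ 0 := by
    rintro rfl
    exact hline α (by simp)
  have hbb' := hbb
  simp only [mul_add, add_mul, mul_smul_comm, smul_mul_assoc, haa, hav, hva, hvv] at hbb'
  obtain ⟨h1, h2⟩ := hind (α * α + β * β * c - α) (α * β * (m + n) - β)
    (by linear_combination (norm := module) hbb')
  have hcomm := hb.comm a
  simp only [mul_add, add_mul, mul_smul_comm, smul_mul_assoc, smul_add, haa, hav, hva, hvv]
    at hcomm
  obtain ⟨h3, h4⟩ := hind (β * β * c * (m - n)) (α * β * (m - n) * (m + n - 1))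
    (by linear_combination (norm := module) hcomm)
  have hα : α * (m + n) = 1 := by
    apply mul_left_cancel₀ hβ
    linear_combination h2
  have hα0 : α ≠ 0 := left_ne_zero_of_mul_eq_one hα
  have hc : c = 0 := by simpa [hβ, sub_eq_zero, hmn] using h3
  have hadd : m + n = 1 := by simpa [hβ, hα0, sub_eq_zero, hmn] using h4
  have hα1 : α = 1 := by rwa [hadd, mul_one] at hα
  subst hc hα1
  rw [zero_smul] at hvv
  have hm' : m = l := by
    refine hm.resolve_left fun h => ?_
    have := ha.toRight.d_ne_one
    grind
  have hn' : n = d := by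
    refine hn.resolve_left fun h => ?_
    have := ha.toLeft.l_ne_one
    grind
  subst hm' hn'
  have hv0 : v ≠ 0 := by
    rintro rfl
    simpa using hind 0 1
  have hbv : ((1 : F) • a + β • v) * v = m • v := by
    rw [add_mul, smul_mul_assoc, smul_mul_assoc, hav, hvv, one_smul, smul_zero, add_zero]
  have hvb : v * ((1 : F) • a + β • v) = n • v := by
    rw [mul_add, mul_smul_comm, mul_smul_comm, hva, hvv, one_smul, smul_zero, add_zero]
  have hl' : m = l' := by
    have h := hb.toLeft.cube v
    simp only [hbv, mul_smul_comm] at h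
    have h' : (m * (m - 1) * (m - l')) • v = 0 := by
      linear_combination (norm := module) h
    simpa [hv0, sub_eq_zero, ha.toLeft.l_ne_zero, ha.toLeft.l_ne_one] using h'
  have hd' : n = d' := by
    have h := hb.toRight.cube v
    simp only [hvb, smul_mul_assoc] at h
    have h' : (n * (n - 1) * (n - d')) • v = 0 := by
      linear_combination (norm := module) h
    simpa [hv0, sub_eq_zero, ha.toRight.d_ne_zero, ha.toRight.d_ne_one] using h'
  obtain rfl : n = 1 - m := by linear_combination hadd
  refine ⟨Or.inr ⟨hl'.symm, hd'.symm, hadd, hmn, ?_, ?_⟩, fun x y => ?_⟩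
  · simp only [mul_add, mul_smul_comm, haa, hav]
    module
  · simp only [add_mul, smul_mul_assoc, haa, hva]
    module
  · obtain ⟨p, q, rfl⟩ := hspan x
    obtain ⟨r, s, rfl⟩ := hspan y
    simp only [mul_add, add_mul, mul_smul_comm, smul_mul_assoc, smul_add, haa, hav, hva, hvv,
      smul_zero, mul_zero, zero_mul]
    module
end

section
/- Let λ, δ ∈ F \ {0,1} with λ + δ = 1 and λ ≠ δ, and let A = F·a ⊕ F·b be the 2-dimensional F-algebra with multiplication determined by a² = a, b² = b, a·b = δ·a + λ·b, b·a = λ·a + δ·b. Then A is flexible, a and b are axes of Jordan type (λ,δ), A_0(L_a) = A_0(L_b) = 0, A_{λ,δ}(a) = A_{λ,δ}(b) = F·(a − b), and (a − b)² = 0. -/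
/-! Common definitions: eigenspaces of left/right multiplication, axes, Jordan axes,
in a not-necessarily-associative, not-necessarily-commutative, not-necessarily-unital
algebra `A` over a field `F`. -/

variable (F : Type*) [Field F]
variable (A : Type*) [NonUnitalNonAssocRing A] [Module F A]
  [SMulCommClass F A A] [IsScalarTower F A A]

section TwoDimensional

open Module

section Eigenspaces

variable {K V : Type*} [Field K] [AddCommGroup V] [Module K V] {f : End K V} {a c : V} {m : K}

theorem eigenspace_eq_bot_of_pair (hind : LinearIndependent K ![a, c])
    (hspan : ∀ v, ∃ s t : K, v = s • a + t • c) (ha : f a = a) (hc : f c = m • c)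
    {k : K} (hk : k ≠ 1) (hkm : k ≠ m) : f.eigenspace k = ⊥ := by
  rw [eq_bot_iff]
  intro v hv
  obtain ⟨s, t, rfl⟩ := hspan v
  have h : (s * (1 - k)) • a + (t * (m - k)) • c = 0 := by
    have := sub_eq_zero.2 (End.mem_eigenspace_iff.1 hv)
    simp only [map_add, map_smul, ha, hc] at this
    rw [← this]; module
  obtain ⟨hs, ht⟩ := LinearIndependent.pair_iff.1 hind _ _ h
  have hs' : s = 0 := by simpa [sub_eq_zero, hk.symm] using hs
  have ht' : t = 0 := by simpa [sub_eq_zero, hkm.symm] using ht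
  simp [hs', ht']

theorem eigenspace_one_eq_span_of_pair (hind : LinearIndependent K ![a, c])
    (hspan : ∀ v, ∃ s t : K, v = s • a + t • c) (ha : f a = a) (hc : f c = m • c)
    (hm : m ≠ 1) : f.eigenspace 1 = K ∙ a := by
  refine le_antisymm (fun v hv ↦ ?_) ?_
  · obtain ⟨s, t, rfl⟩ := hspan v
    have h : (0 : K) • a + (t * (m - 1)) • c = 0 := by
      have := sub_eq_zero.2 (End.mem_eigenspace_iff.1 hv)
      simp only [map_add, map_smul, ha, hc] at this
      rw [← this]; module
    obtain ⟨-, ht⟩ := LinearIndependent.pair_iff.1 hind _ _ h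
    have : t = 0 := by simpa [sub_eq_zero, hm] using ht
    simp [this, Submodule.mem_span_singleton]
  · simp [Submodule.span_singleton_le_iff_mem, ha]

theorem eigenspace_eq_span_of_pair (hind : LinearIndependent K ![a, c])
    (hspan : ∀ v, ∃ s t : K, v = s • a + t • c) (ha : f a = a) (hc : f c = m • c)
    (hm : m ≠ 1) : f.eigenspace m = K ∙ c := by
  refine le_antisymm (fun v hv ↦ ?_) ?_
  · obtain ⟨s, t, rfl⟩ := hspan v
    have h : (s * (1 - m)) • a + (0 : K) • c = 0 := by
      have := sub_eq_zero.2 (End.mem_eigenspace_iff.1 hv)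
      simp only [map_add, map_smul, ha, hc] at this
      rw [← this]; module
    obtain ⟨hs, -⟩ := LinearIndependent.pair_iff.1 hind _ _ h
    have : s = 0 := by simpa [sub_eq_zero, hm.symm] using hs
    simp [this, Submodule.mem_span_singleton]
  · simp [Submodule.span_singleton_le_iff_mem, hc]

end Eigenspaces

variable {K B : Type*} [Field K] [NonUnitalNonAssocRing B] [Module K B] {l d : K} {a c : B}

theorem leftEig_eq_eigenspace [SMulCommClass K B B] (a : B) (k : K) :
    leftEig K B a k = End.eigenspace (LinearMap.mulLeft K a) k := by
  ext v
  rw [End.mem_eigenspace_iff]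
  rfl

theorem rightEig_eq_eigenspace [IsScalarTower K B B] (a : B) (k : K) :
    rightEig K B a k = End.eigenspace (LinearMap.mulRight K a) k := by
  ext v
  rw [End.mem_eigenspace_iff]
  rfl

/-- `B` is spanned by the independent vectors `a` and `c`, where `a` is idempotent, `c` squares to
zero and is an eigenvector of left and right multiplication by `a`. -/
structure IsNilPair (l d : K) (a c : B) : Prop where
  linearIndependent : LinearIndependent K ![a, c]
  exists_eq (v : B) : ∃ s t : K, v = s • a + t • c
  idem : a * a = a
  mul_right : a * c = l • c
  mul_left : c * a = d • c
  sq_zero : c * c = 0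

namespace IsNilPair

theorem span_sup_span (h : IsNilPair l d a c) : (K ∙ a) ⊔ (K ∙ c) = ⊤ := by
  refine eq_top_iff.2 fun v _ ↦ ?_
  obtain ⟨s, t, rfl⟩ := h.exists_eq v
  exact Submodule.add_mem_sup (Submodule.smul_mem _ s (Submodule.mem_span_singleton_self a))
    (Submodule.smul_mem _ t (Submodule.mem_span_singleton_self c))

theorem leftEig_zero [SMulCommClass K B B] (h : IsNilPair l d a c) (hl : l ≠ 0) :
    leftEig K B a 0 = ⊥ := by
  rw [leftEig_eq_eigenspace]
  exact eigenspace_eq_bot_of_pair h.linearIndependent h.exists_eq h.idem h.mul_right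
    zero_ne_one hl.symm

theorem leftEig_one [SMulCommClass K B B] (h : IsNilPair l d a c) (hl : l ≠ 1) :
    leftEig K B a 1 = K ∙ a := by
  rw [leftEig_eq_eigenspace]
  exact eigenspace_one_eq_span_of_pair h.linearIndependent h.exists_eq h.idem h.mul_right hl

theorem leftEig_self [SMulCommClass K B B] (h : IsNilPair l d a c) (hl : l ≠ 1) :
    leftEig K B a l = K ∙ c := by
  rw [leftEig_eq_eigenspace]
  exact eigenspace_eq_span_of_pair h.linearIndependent h.exists_eq h.idem h.mul_right hl

theorem rightEig_zero [IsScalarTower K B B] (h : IsNilPair l d a c) (hd : d ≠ 0) :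
    rightEig K B a 0 = ⊥ := by
  rw [rightEig_eq_eigenspace]
  exact eigenspace_eq_bot_of_pair h.linearIndependent h.exists_eq h.idem h.mul_left
    zero_ne_one hd.symm

theorem rightEig_one [IsScalarTower K B B] (h : IsNilPair l d a c) (hd : d ≠ 1) :
    rightEig K B a 1 = K ∙ a := by
  rw [rightEig_eq_eigenspace]
  exact eigenspace_one_eq_span_of_pair h.linearIndependent h.exists_eq h.idem h.mul_left hd

theorem rightEig_self [IsScalarTower K B B] (h : IsNilPair l d a c) (hd : d ≠ 1) :
    rightEig K B a d = K ∙ c := by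
  rw [rightEig_eq_eigenspace]
  exact eigenspace_eq_span_of_pair h.linearIndependent h.exists_eq h.idem h.mul_left hd

variable [SMulCommClass K B B] [IsScalarTower K B B]

theorem eig2_self (h : IsNilPair l d a c) (hl : l ≠ 1) (hd : d ≠ 1) :
    eig2 K B a l d = K ∙ c := by
  rw [eig2, h.leftEig_self hl, h.rightEig_self hd, inf_idem]

theorem mul_mem_plus_plus (h : IsNilPair l d a c) {x y : B} (hx : x ∈ K ∙ a) (hy : y ∈ K ∙ a) :
    x * y ∈ K ∙ a := by
  obtain ⟨s, rfl⟩ := Submodule.mem_span_singleton.1 hx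
  obtain ⟨t, rfl⟩ := Submodule.mem_span_singleton.1 hy
  refine Submodule.mem_span_singleton.2 ⟨s * t, ?_⟩
  rw [smul_mul_smul_comm, h.idem]

theorem mul_mem_plus_minus (h : IsNilPair l d a c) {x y : B} (hx : x ∈ K ∙ a) (hy : y ∈ K ∙ c) :
    x * y ∈ K ∙ c := by
  obtain ⟨s, rfl⟩ := Submodule.mem_span_singleton.1 hx
  obtain ⟨t, rfl⟩ := Submodule.mem_span_singleton.1 hy
  refine Submodule.mem_span_singleton.2 ⟨s * t * l, ?_⟩
  rw [smul_mul_smul_comm, h.mul_right, smul_smul]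

theorem mul_mem_minus_plus (h : IsNilPair l d a c) {x y : B} (hx : x ∈ K ∙ c) (hy : y ∈ K ∙ a) :
    x * y ∈ K ∙ c := by
  obtain ⟨s, rfl⟩ := Submodule.mem_span_singleton.1 hx
  obtain ⟨t, rfl⟩ := Submodule.mem_span_singleton.1 hy
  refine Submodule.mem_span_singleton.2 ⟨s * t * d, ?_⟩
  rw [smul_mul_smul_comm, h.mul_left, smul_smul]

theorem mul_mem_minus_minus (h : IsNilPair l d a c) {x y : B} (hx : x ∈ K ∙ c) (hy : y ∈ K ∙ c) :
    x * y ∈ K ∙ a := by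
  obtain ⟨s, rfl⟩ := Submodule.mem_span_singleton.1 hx
  obtain ⟨t, rfl⟩ := Submodule.mem_span_singleton.1 hy
  rw [smul_mul_smul_comm, h.sq_zero, smul_zero]
  exact zero_mem _

theorem isLeftAxis (h : IsNilPair l d a c) (hl0 : l ≠ 0) (hl1 : l ≠ 1) : IsLeftAxis K B l a := by
  have hplus : leftEig K B a 0 ⊔ leftEig K B a 1 = K ∙ a := by
    rw [h.leftEig_zero hl0, h.leftEig_one hl1, bot_sup_eq]
  have hminus := h.leftEig_self hl1
  refine ⟨hl0, hl1, h.idem, h.leftEig_one hl1, fun v ↦ ?_, ?_, ?_, ?_, ?_, ?_⟩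
  · obtain ⟨s, t, rfl⟩ := h.exists_eq v
    simp only [mul_add, mul_smul_comm, h.idem, h.mul_right]
    module
  · rw [hplus, hminus, h.span_sup_span]
  all_goals simp only [hplus, hminus]; intro x hx y hy
  exacts [h.mul_mem_plus_plus hx hy, h.mul_mem_plus_minus hx hy, h.mul_mem_minus_plus hx hy,
    h.mul_mem_minus_minus hx hy]

theorem isRightAxis (h : IsNilPair l d a c) (hd0 : d ≠ 0) (hd1 : d ≠ 1) :
    IsRightAxis K B d a := by
  have hplus : rightEig K B a 0 ⊔ rightEig K B a 1 = K ∙ a := by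
    rw [h.rightEig_zero hd0, h.rightEig_one hd1, bot_sup_eq]
  have hminus := h.rightEig_self hd1
  refine ⟨hd0, hd1, h.idem, h.rightEig_one hd1, fun v ↦ ?_, ?_, ?_, ?_, ?_, ?_⟩
  · obtain ⟨s, t, rfl⟩ := h.exists_eq v
    simp only [add_mul, smul_mul_assoc, h.idem, h.mul_left]
    module
  · rw [hplus, hminus, h.span_sup_span]
  all_goals simp only [hplus, hminus]; intro x hx y hy
  exacts [h.mul_mem_plus_plus hx hy, h.mul_mem_plus_minus hx hy, h.mul_mem_minus_plus hx hy,
    h.mul_mem_minus_minus hx hy]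

theorem isJordanAxis (h : IsNilPair l d a c) (hl0 : l ≠ 0) (hl1 : l ≠ 1) (hd0 : d ≠ 0)
    (hd1 : d ≠ 1) : IsJordanAxis K B l d a where
  toLeft := h.isLeftAxis hl0 hl1
  toRight := h.isRightAxis hd0 hd1
  comm v := by
    obtain ⟨s, t, rfl⟩ := h.exists_eq v
    simp only [add_mul, mul_add, smul_mul_assoc, mul_smul_comm, h.idem, h.mul_left, h.mul_right]
    module
  j_left := by rw [eig2, h.rightEig_zero hd0, inf_bot_eq]
  j_right := by rw [eig2, h.leftEig_zero hl0, bot_inf_eq]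

theorem flexible (h : IsNilPair l d a c) (hsum : l + d = 1) (x y : B) :
    (x * y) * x = x * (y * x) := by
  obtain ⟨s, t, rfl⟩ := h.exists_eq x
  obtain ⟨u, v, rfl⟩ := h.exists_eq y
  obtain rfl : d = 1 - l := by rw [← hsum]; ring
  simp only [add_mul, mul_add, smul_mul_assoc, mul_smul_comm, h.idem, h.mul_left, h.mul_right,
    h.sq_zero, smul_zero, add_zero]
  module

end IsNilPair

end TwoDimensional

/-- the 2-dimensional example `A = F·a ⊕ F·b` with `a² = a`, `b² = b`,
`a*b = d•a + l•b`, `b*a = l•a + d•b`, where `l + d = 1`, `l ≠ d`, `l, d ∉ {0,1}`: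
`A` is flexible, `a` and `b` are axes of Jordan type `(l, d)`,
`A_0(L_a) = A_0(L_b) = 0`, `A_{l,d}(a) = A_{l,d}(b) = F·(a - b)`, and `(a - b)² = 0`. -/
theorem example_dim_two (hchar : (2 : F) ≠ 0) (l d : F)
    (hl0 : l ≠ 0) (hl1 : l ≠ 1) (hd0 : d ≠ 0) (hd1 : d ≠ 1)
    (hsum : l + d = 1) (hne : l ≠ d) (a b : A)
    (hind : LinearIndependent F ![a, b]) (hspan : Submodule.span F {a, b} = ⊤)
    (haa : a * a = a) (hbb : b * b = b)
    (hab : a * b = d • a + l • b) (hba : b * a = l • a + d • b) :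
    (∀ x y : A, (x * y) * x = x * (y * x)) ∧
    IsJordanAxis F A l d a ∧ IsJordanAxis F A l d b ∧
    leftEig F A a 0 = ⊥ ∧ leftEig F A b 0 = ⊥ ∧
    eig2 F A a l d = Submodule.span F {a - b} ∧
    eig2 F A b l d = Submodule.span F {a - b} ∧
    (a - b) * (a - b) = 0 := by
  have hmul_a : a * (a - b) = l • (a - b) := by
    obtain rfl : d = 1 - l := by rw [← hsum]; ring
    rw [mul_sub, haa, hab]; module
  have hmul_b : b * (a - b) = l • (a - b) := by
    obtain rfl : d = 1 - l := by rw [← hsum]; ring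
    rw [mul_sub, hbb, hba]; module
  have ha_mul : (a - b) * a = d • (a - b) := by
    obtain rfl : d = 1 - l := by rw [← hsum]; ring
    rw [sub_mul, haa, hba]; module
  have hb_mul : (a - b) * b = d • (a - b) := by
    obtain rfl : d = 1 - l := by rw [← hsum]; ring
    rw [sub_mul, hbb, hab]; module
  have hsq : (a - b) * (a - b) = 0 := by
    rw [sub_mul, hmul_a, hmul_b, sub_self]
  have hcoord (v : A) : ∃ s t : F, s • a + t • b = v :=
    Submodule.mem_span_pair.1 (hspan ▸ Submodule.mem_top)
  have hpair := LinearIndependent.pair_iff.1 hind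
  have hA : IsNilPair l d a (a - b) := by
    refine ⟨LinearIndependent.pair_iff.2 fun s t hst ↦ ?_, fun v ↦ ?_, haa, hmul_a, ha_mul, hsq⟩
    · obtain ⟨h1, h2⟩ := hpair (s + t) (-t) (by rw [← hst]; module)
      have ht : t = 0 := neg_eq_zero.1 h2
      exact ⟨by rwa [ht, add_zero] at h1, ht⟩
    · obtain ⟨s, t, rfl⟩ := hcoord v
      exact ⟨s + t, -t, by module⟩
  have hB : IsNilPair l d b (a - b) := by
    refine ⟨LinearIndependent.pair_iff.2 fun s t hst ↦ ?_, fun v ↦ ?_, hbb, hmul_b, hb_mul, hsq⟩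
    · obtain ⟨h1, h2⟩ := hpair t (s - t) (by rw [← hst]; module)
      exact ⟨by rwa [h1, sub_zero] at h2, h1⟩
    · obtain ⟨s, t, rfl⟩ := hcoord v
      exact ⟨s + t, s, by module⟩
  exact ⟨hA.flexible hsum, hA.isJordanAxis hl0 hl1 hd0 hd1, hB.isJordanAxis hl0 hl1 hd0 hd1,
    hA.leftEig_zero hl0, hB.leftEig_zero hl0, hA.eig2_self hl1 hd1, hB.eig2_self hl1 hd1, hsq⟩
end

section
/- Let λ, δ ∈ F \ {0,1} with λ + δ = 1 and λ ≠ δ, and let A = F·a ⊕ F·b ⊕ F·x be the 3-dimensional F-algebra with multiplication determined by a² = a, b² = b, x² = 0, a·b = a·x = x·b = λ·x, b·a = x·a = b·x = δ·x. Then A is flexible, a is an axis of Jordan type (λ,δ), and b and b − x are axes of Jordan type (δ,λ); moreover A_{λ,δ}(a) = F·x and A_{0,0}(a) = F·(b − x). -/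
/-! Common definitions: eigenspaces of left/right multiplication, axes, Jordan axes,
in a not-necessarily-associative, not-necessarily-commutative, not-necessarily-unital
algebra `A` over a field `F`. -/

variable (F : Type*) [Field F]
variable (A : Type*) [NonUnitalNonAssocRing A] [Module F A]
  [SMulCommClass F A A] [IsScalarTower F A A]

/-- `a`, `c`, `x` form a basis of `A` in which `a`, `c` are orthogonal idempotents, `x` squares to
zero and is a simultaneous eigenvector of the multiplications by `a` and by `c`. -/
structure IsIdempotentBasis (l d : F) (a c x : A) : Prop where
  indep : ∀ r s t : F, r • a + s • c + t • x = 0 → r = 0 ∧ s = 0 ∧ t = 0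
  exists_eq : ∀ v : A, ∃ r s t : F, v = r • a + s • c + t • x
  aa : a * a = a
  cc : c * c = c
  xx : x * x = 0
  ac : a * c = 0
  ca : c * a = 0
  ax : a * x = l • x
  xa : x * a = d • x
  cx : c * x = d • x
  xc : x * c = l • x

namespace IsIdempotentBasis

set_option linter.unusedSectionVars false

variable {F A}
variable {l d : F} {a c x : A}

theorem swap (h : IsIdempotentBasis F A l d a c x) : IsIdempotentBasis F A d l c a x where
  indep r s t e := by
    obtain ⟨hs, hr, ht⟩ := h.indep s r t (by rw [← e]; module)
    exact ⟨hr, hs, ht⟩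
  exists_eq v := by
    obtain ⟨r, s, t, rfl⟩ := h.exists_eq v
    exact ⟨s, r, t, by module⟩
  aa := h.cc
  cc := h.aa
  xx := h.xx
  ac := h.ca
  ca := h.ac
  ax := h.cx
  xa := h.xc
  cx := h.ax
  xc := h.xa

theorem mul_eq (h : IsIdempotentBasis F A l d a c x) (r s t r' s' t' : F) :
    (r • a + s • c + t • x) * (r' • a + s' • c + t' • x) =
      (r * r') • a + (s * s') • c + (l * r * t' + d * t * r' + d * s * t' + l * t * s') • x := by
  simp only [mul_add, add_mul, smul_mul_assoc, mul_smul_comm, h.aa, h.cc, h.xx, h.ac, h.ca, h.ax,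
    h.xa, h.cx, h.xc, smul_zero]
  module

theorem left_mul_eq (h : IsIdempotentBasis F A l d a c x) (r s t : F) :
    a * (r • a + s • c + t • x) = r • a + (t * l) • x := by
  simp only [mul_add, mul_smul_comm, h.aa, h.ac, h.ax, smul_zero]
  module

theorem right_mul_eq (h : IsIdempotentBasis F A l d a c x) (r s t : F) :
    (r • a + s • c + t • x) * a = r • a + (t * d) • x := by
  simp only [add_mul, smul_mul_assoc, h.aa, h.ca, h.xa, smul_zero]
  module

theorem mem_leftEig (h : IsIdempotentBasis F A l d a c x) (m r s t : F) :
    r • a + s • c + t • x ∈ leftEig F A a m ↔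
      r * (1 - m) = 0 ∧ s * m = 0 ∧ t * (l - m) = 0 := by
  change a * (r • a + s • c + t • x) = m • (r • a + s • c + t • x) ↔ _
  rw [h.left_mul_eq, ← sub_eq_zero]
  have e : r • a + (t * l) • x - m • (r • a + s • c + t • x) =
      (r * (1 - m)) • a + (-(s * m)) • c + (t * (l - m)) • x := by module
  rw [e]
  refine ⟨fun h0 => by simpa using h.indep _ _ _ h0, ?_⟩
  rintro ⟨h1, h2, h3⟩
  simp [h1, h2, h3]

theorem mem_rightEig (h : IsIdempotentBasis F A l d a c x) (m r s t : F) :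
    r • a + s • c + t • x ∈ rightEig F A a m ↔
      r * (1 - m) = 0 ∧ s * m = 0 ∧ t * (d - m) = 0 := by
  change (r • a + s • c + t • x) * a = m • (r • a + s • c + t • x) ↔ _
  rw [h.right_mul_eq, ← sub_eq_zero]
  have e : r • a + (t * d) • x - m • (r • a + s • c + t • x) =
      (r * (1 - m)) • a + (-(s * m)) • c + (t * (d - m)) • x := by module
  rw [e]
  refine ⟨fun h0 => by simpa using h.indep _ _ _ h0, ?_⟩
  rintro ⟨h1, h2, h3⟩
  simp [h1, h2, h3]

theorem mem_span_x (h : IsIdempotentBasis F A l d a c x) (r s t : F) :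
    r • a + s • c + t • x ∈ Submodule.span F {x} ↔ r = 0 ∧ s = 0 := by
  rw [Submodule.mem_span_singleton]
  constructor
  · rintro ⟨k, hk⟩
    obtain ⟨hr, hs, -⟩ := h.indep r s (t - k) (by rw [sub_smul, hk]; module)
    exact ⟨hr, hs⟩
  · rintro ⟨rfl, rfl⟩
    exact ⟨t, by simp⟩

theorem mem_span_a (h : IsIdempotentBasis F A l d a c x) (r s t : F) :
    r • a + s • c + t • x ∈ Submodule.span F {a} ↔ s = 0 ∧ t = 0 := by
  rw [Submodule.mem_span_singleton]
  constructor
  · rintro ⟨k, hk⟩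
    exact (h.indep (r - k) s t (by rw [sub_smul, hk]; module)).2
  · rintro ⟨rfl, rfl⟩
    exact ⟨r, by simp⟩

theorem mem_span_c (h : IsIdempotentBasis F A l d a c x) (r s t : F) :
    r • a + s • c + t • x ∈ Submodule.span F {c} ↔ r = 0 ∧ t = 0 := by
  rw [← h.swap.mem_span_a s r t, add_comm (s • c)]

theorem mem_span_sup (h : IsIdempotentBasis F A l d a c x) (r s t : F) :
    r • a + s • c + t • x ∈ Submodule.span F {c} ⊔ Submodule.span F {a} ↔ t = 0 := by
  rw [← Submodule.span_union, Set.singleton_union, Submodule.mem_span_pair]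
  constructor
  · rintro ⟨k, m, hk⟩
    exact (h.indep (r - m) (s - k) t (by
      rw [sub_smul, sub_smul, ← sub_eq_zero.2 hk.symm]
      module)).2.2
  · rintro rfl
    exact ⟨s, r, by module⟩

theorem span_sup_eq_top (h : IsIdempotentBasis F A l d a c x) :
    Submodule.span F {c} ⊔ Submodule.span F {a} ⊔ Submodule.span F {x} = ⊤ := by
  refine eq_top_iff.2 fun v _ => ?_
  obtain ⟨r, s, t, rfl⟩ := h.exists_eq v
  refine Submodule.add_mem_sup ?_ (Submodule.smul_mem _ t (Submodule.mem_span_singleton_self x))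
  simpa using (h.mem_span_sup r s 0).2 rfl

theorem leftEig_zero (h : IsIdempotentBasis F A l d a c x) (hl : l ≠ 0) :
    leftEig F A a 0 = Submodule.span F {c} := by
  ext v
  obtain ⟨r, s, t, rfl⟩ := h.exists_eq v
  simp [h.mem_leftEig, h.mem_span_c, hl]

theorem leftEig_one (h : IsIdempotentBasis F A l d a c x) (hl : l ≠ 1) :
    leftEig F A a 1 = Submodule.span F {a} := by
  ext v
  obtain ⟨r, s, t, rfl⟩ := h.exists_eq v
  simp [h.mem_leftEig, h.mem_span_a, sub_eq_zero, hl]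

theorem leftEig_self (h : IsIdempotentBasis F A l d a c x) (hl0 : l ≠ 0) (hl1 : l ≠ 1) :
    leftEig F A a l = Submodule.span F {x} := by
  ext v
  obtain ⟨r, s, t, rfl⟩ := h.exists_eq v
  simp [h.mem_leftEig, h.mem_span_x, sub_eq_zero, hl0, hl1.symm]

theorem rightEig_zero (h : IsIdempotentBasis F A l d a c x) (hd : d ≠ 0) :
    rightEig F A a 0 = Submodule.span F {c} := by
  ext v
  obtain ⟨r, s, t, rfl⟩ := h.exists_eq v
  simp [h.mem_rightEig, h.mem_span_c, hd]

theorem rightEig_one (h : IsIdempotentBasis F A l d a c x) (hd : d ≠ 1) :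
    rightEig F A a 1 = Submodule.span F {a} := by
  ext v
  obtain ⟨r, s, t, rfl⟩ := h.exists_eq v
  simp [h.mem_rightEig, h.mem_span_a, sub_eq_zero, hd]

theorem rightEig_self (h : IsIdempotentBasis F A l d a c x) (hd0 : d ≠ 0) (hd1 : d ≠ 1) :
    rightEig F A a d = Submodule.span F {x} := by
  ext v
  obtain ⟨r, s, t, rfl⟩ := h.exists_eq v
  simp [h.mem_rightEig, h.mem_span_x, sub_eq_zero, hd0, hd1.symm]

theorem mul_mem_plus_plus (h : IsIdempotentBasis F A l d a c x) :
    ∀ y ∈ Submodule.span F {c} ⊔ Submodule.span F {a},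
    ∀ z ∈ Submodule.span F {c} ⊔ Submodule.span F {a},
      y * z ∈ Submodule.span F {c} ⊔ Submodule.span F {a} := by
  intro y hy z hz
  obtain ⟨r, s, t, rfl⟩ := h.exists_eq y
  obtain ⟨r', s', t', rfl⟩ := h.exists_eq z
  rw [h.mem_span_sup] at hy hz
  rw [h.mul_eq, h.mem_span_sup]
  simp [hy, hz]

theorem mul_mem_plus_minus (h : IsIdempotentBasis F A l d a c x) :
    ∀ y ∈ Submodule.span F {c} ⊔ Submodule.span F {a}, ∀ z ∈ Submodule.span F {x},
      y * z ∈ Submodule.span F {x} := by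
  intro y _ z hz
  obtain ⟨r, s, t, rfl⟩ := h.exists_eq y
  obtain ⟨r', s', t', rfl⟩ := h.exists_eq z
  rw [h.mem_span_x] at hz
  rw [h.mul_eq, h.mem_span_x]
  simp [hz]

theorem mul_mem_minus_plus (h : IsIdempotentBasis F A l d a c x) :
    ∀ y ∈ Submodule.span F {x}, ∀ z ∈ Submodule.span F {c} ⊔ Submodule.span F {a},
      y * z ∈ Submodule.span F {x} := by
  intro y hy z _
  obtain ⟨r, s, t, rfl⟩ := h.exists_eq y
  obtain ⟨r', s', t', rfl⟩ := h.exists_eq z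
  rw [h.mem_span_x] at hy
  rw [h.mul_eq, h.mem_span_x]
  simp [hy]

theorem mul_mem_minus_minus (h : IsIdempotentBasis F A l d a c x) :
    ∀ y ∈ Submodule.span F {x}, ∀ z ∈ Submodule.span F {x},
      y * z ∈ Submodule.span F {c} ⊔ Submodule.span F {a} := by
  intro y hy z hz
  obtain ⟨r, s, t, rfl⟩ := h.exists_eq y
  obtain ⟨r', s', t', rfl⟩ := h.exists_eq z
  rw [h.mem_span_x] at hy hz
  rw [h.mul_eq, h.mem_span_sup]
  simp [hy, hz]

theorem isLeftAxis (h : IsIdempotentBasis F A l d a c x) (hl0 : l ≠ 0) (hl1 : l ≠ 1) :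
    IsLeftAxis F A l a where
  l_ne_zero := hl0
  l_ne_one := hl1
  idem := h.aa
  prim := h.leftEig_one hl1
  cube v := by
    obtain ⟨r, s, t, rfl⟩ := h.exists_eq v
    simp only [h.left_mul_eq, mul_add, mul_smul_comm, h.aa, h.ax]
    module
  decomp := by
    rw [h.leftEig_zero hl0, h.leftEig_one hl1, h.leftEig_self hl0 hl1]
    exact h.span_sup_eq_top
  fusePP := by
    rw [h.leftEig_zero hl0, h.leftEig_one hl1]
    exact h.mul_mem_plus_plus
  fusePM := by
    rw [h.leftEig_zero hl0, h.leftEig_one hl1, h.leftEig_self hl0 hl1]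
    exact h.mul_mem_plus_minus
  fuseMP := by
    rw [h.leftEig_zero hl0, h.leftEig_one hl1, h.leftEig_self hl0 hl1]
    exact h.mul_mem_minus_plus
  fuseMM := by
    rw [h.leftEig_zero hl0, h.leftEig_one hl1, h.leftEig_self hl0 hl1]
    exact h.mul_mem_minus_minus

theorem isRightAxis (h : IsIdempotentBasis F A l d a c x) (hd0 : d ≠ 0) (hd1 : d ≠ 1) :
    IsRightAxis F A d a where
  d_ne_zero := hd0
  d_ne_one := hd1
  idem := h.aa
  prim := h.rightEig_one hd1
  cube v := by
    obtain ⟨r, s, t, rfl⟩ := h.exists_eq v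
    simp only [h.right_mul_eq, add_mul, smul_mul_assoc, h.aa, h.xa]
    module
  decomp := by
    rw [h.rightEig_zero hd0, h.rightEig_one hd1, h.rightEig_self hd0 hd1]
    exact h.span_sup_eq_top
  fusePP := by
    rw [h.rightEig_zero hd0, h.rightEig_one hd1]
    exact h.mul_mem_plus_plus
  fusePM := by
    rw [h.rightEig_zero hd0, h.rightEig_one hd1, h.rightEig_self hd0 hd1]
    exact h.mul_mem_plus_minus
  fuseMP := by
    rw [h.rightEig_zero hd0, h.rightEig_one hd1, h.rightEig_self hd0 hd1]
    exact h.mul_mem_minus_plus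
  fuseMM := by
    rw [h.rightEig_zero hd0, h.rightEig_one hd1, h.rightEig_self hd0 hd1]
    exact h.mul_mem_minus_minus

theorem isJordanAxis (h : IsIdempotentBasis F A l d a c x) (hl0 : l ≠ 0) (hl1 : l ≠ 1)
    (hd0 : d ≠ 0) (hd1 : d ≠ 1) : IsJordanAxis F A l d a where
  toLeft := h.isLeftAxis hl0 hl1
  toRight := h.isRightAxis hd0 hd1
  comm v := by
    obtain ⟨r, s, t, rfl⟩ := h.exists_eq v
    simp only [h.left_mul_eq, h.right_mul_eq, mul_add, add_mul, mul_smul_comm, smul_mul_assoc,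
      h.aa, h.ax, h.xa]
    module
  j_left := by
    refine eq_bot_iff.2 fun v hv => ?_
    obtain ⟨r, s, t, rfl⟩ := h.exists_eq v
    obtain ⟨h1, h2⟩ := Submodule.mem_inf.1 hv
    rw [h.mem_leftEig] at h1
    rw [h.mem_rightEig] at h2
    simp_all
  j_right := by
    refine eq_bot_iff.2 fun v hv => ?_
    obtain ⟨r, s, t, rfl⟩ := h.exists_eq v
    obtain ⟨h1, h2⟩ := Submodule.mem_inf.1 hv
    rw [h.mem_leftEig] at h1
    rw [h.mem_rightEig] at h2
    simp_all

theorem flexible (h : IsIdempotentBasis F A l d a c x) (hsum : l + d = 1) (y z : A) :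
    (y * z) * y = y * (z * y) := by
  obtain ⟨r, s, t, rfl⟩ := h.exists_eq y
  obtain ⟨r', s', t', rfl⟩ := h.exists_eq z
  obtain rfl : d = 1 - l := by rw [← hsum]; ring
  simp only [h.mul_eq]
  module

end IsIdempotentBasis

/-- the 3-dimensional example `A = F·a ⊕ F·b ⊕ F·x` with `a² = a`, `b² = b`,
`x² = 0`, `a*b = a*x = x*b = l•x`, `b*a = x*a = b*x = d•x`, where `l + d = 1`, `l ≠ d`:
`A` is flexible, `a` is an axis of Jordan type `(l, d)`, `b` and `b - x` are axes of Jordan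
type `(d, l)`, `A_{l,d}(a) = F·x` and `A_{0,0}(a) = F·(b - x)`. -/
theorem example_dim_three (hchar : (2 : F) ≠ 0) (l d : F)
    (hl0 : l ≠ 0) (hl1 : l ≠ 1) (hd0 : d ≠ 0) (hd1 : d ≠ 1)
    (hsum : l + d = 1) (hne : l ≠ d) (a b x : A)
    (hind : LinearIndependent F ![a, b, x]) (hspan : Submodule.span F {a, b, x} = ⊤)
    (haa : a * a = a) (hbb : b * b = b) (hxx : x * x = 0)
    (hab : a * b = l • x) (hax : a * x = l • x) (hxb : x * b = l • x)
    (hba : b * a = d • x) (hxa : x * a = d • x) (hbx : b * x = d • x) :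
    (∀ y z : A, (y * z) * y = y * (z * y)) ∧
    IsJordanAxis F A l d a ∧ IsJordanAxis F A d l b ∧ IsJordanAxis F A d l (b - x) ∧
    eig2 F A a l d = Submodule.span F {x} ∧
    eig2 F A a 0 0 = Submodule.span F {b - x} := by
  have indep (r s t : F) (e : r • a + s • b + t • x = 0) : r = 0 ∧ s = 0 ∧ t = 0 := by
    have h0 := Fintype.linearIndependent_iff.1 hind ![r, s, t]
      (by simpa [Fin.sum_univ_three] using e)
    exact ⟨h0 0, h0 1, h0 2⟩
  have exists_eq (v : A) : ∃ r s t : F, v = r • a + s • b + t • x := by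
    have hv : v ∈ Submodule.span F {a, b, x} := hspan ▸ Submodule.mem_top
    obtain ⟨r, s, t, e⟩ := Submodule.mem_span_triple.1 hv
    exact ⟨r, s, t, e.symm⟩
  have ha : IsIdempotentBasis F A l d a (b - x) x :=
    { indep := fun r s t e => by
        obtain ⟨hr, hs, ht⟩ := indep r s (t - s) (by rw [← e]; module)
        exact ⟨hr, hs, by simpa [hs] using ht⟩
      exists_eq := fun v => by
        obtain ⟨r, s, t, rfl⟩ := exists_eq v
        exact ⟨r, s, t + s, by module⟩
      aa := haa
      cc := by
        simp only [mul_sub, sub_mul, hbb, hbx, hxb, hxx]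
        have e : b - l • x - (d • x - 0) = b - (l + d) • x := by module
        rw [e, hsum, one_smul]
      xx := hxx
      ac := by rw [mul_sub, hab, hax, sub_self]
      ca := by rw [sub_mul, hba, hxa, sub_self]
      ax := hax
      xa := hxa
      cx := by rw [sub_mul, hbx, hxx, sub_zero]
      xc := by rw [mul_sub, hxb, hxx, sub_zero] }
  have hb : IsIdempotentBasis F A d l b (a - x) x :=
    { indep := fun r s t e => by
        obtain ⟨hs, hr, ht⟩ := indep s r (t - s) (by rw [← e]; module)
        exact ⟨hr, hs, by simpa [hs] using ht⟩
      exists_eq := fun v => by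
        obtain ⟨r, s, t, rfl⟩ := exists_eq v
        exact ⟨s, r, t + r, by module⟩
      aa := hbb
      cc := by
        simp only [mul_sub, sub_mul, haa, hax, hxa, hxx]
        have e : a - d • x - (l • x - 0) = a - (l + d) • x := by module
        rw [e, hsum, one_smul]
      xx := hxx
      ac := by rw [mul_sub, hba, hbx, sub_self]
      ca := by rw [sub_mul, hab, hxb, sub_self]
      ax := hbx
      xa := hxb
      cx := by rw [sub_mul, hax, hxx, sub_zero]
      xc := by rw [mul_sub, hxa, hxx, sub_zero] }
  refine ⟨ha.flexible hsum, ha.isJordanAxis hl0 hl1 hd0 hd1, hb.isJordanAxis hd0 hd1 hl0 hl1,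
    ha.swap.isJordanAxis hd0 hd1 hl0 hl1, ?_, ?_⟩
  · rw [eig2, ha.leftEig_self hl0 hl1, ha.rightEig_self hd0 hd1, inf_idem]
  · rw [eig2, ha.leftEig_zero hl0, ha.rightEig_zero hd0, inf_idem]
end

section
/- Suppose A is generated by two axes a and b of Jordan type (λ,λ) and (λ',λ') respectively, dim_F A = 3, and λ = λ'. Write b = α_b·a + b_0 + b_{λ,λ} (components in F·a, A_{0,0}(a), A_{λ,λ}(a)) and a = α_a·b + a_0 + a_{λ',λ'} (components in F·b, A_{0,0}(b), A_{λ',λ'}(b)). Then α_a = α_b. -/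
/-! Common definitions: eigenspaces of left/right multiplication, axes, Jordan axes,
in a not-necessarily-associative, not-necessarily-commutative, not-necessarily-unital
algebra `A` over a field `F`. -/

variable (F : Type*) [Field F]
variable (A : Type*) [NonUnitalNonAssocRing A] [Module F A]
  [SMulCommClass F A A] [IsScalarTower F A A]

section Helpers

variable {F A}

theorem mul_of_decomposition {l α : F} {a b b0 bl : A} (idem : a * a = a)
    (hb0 : b0 ∈ eig2 F A a 0 0) (hbl : bl ∈ eig2 F A a l l) (hb : b = α • a + b0 + bl) :
    a * b = α • a + l • bl ∧ b * a = α • a + l • bl := by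
  have h1 : a * b0 = (0 : F) • b0 := hb0.1
  have h2 : b0 * a = (0 : F) • b0 := hb0.2
  have h3 : a * bl = l • bl := hbl.1
  have h4 : bl * a = l • bl := hbl.2
  constructor
  · rw [hb]; simp only [mul_add, mul_smul_comm, idem, h1, h3]; module
  · rw [hb]; simp only [add_mul, smul_mul_assoc, idem, h2, h4]; module

theorem sub_eq_of_decomposition {l α : F} {a b b0 bl : A} (idem : a * a = a)
    (hb0 : b0 ∈ eig2 F A a 0 0) (hbl : bl ∈ eig2 F A a l l) (hb : b = α • a + b0 + bl) :
    a * b - l • a - l • b = (α * (1 - l) - l) • a - l • b0 := by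
  rw [(mul_of_decomposition idem hb0 hbl hb).1, hb]
  module

theorem mul_sub_of_decomposition {l α : F} {a b b0 bl : A} (idem : a * a = a)
    (hb0 : b0 ∈ eig2 F A a 0 0) (hbl : bl ∈ eig2 F A a l l) (hb : b = α • a + b0 + bl) :
    a * (a * b - l • a - l • b) = (α * (1 - l) - l) • a ∧
      (a * b - l • a - l • b) * a = (α * (1 - l) - l) • a := by
  have h1 : a * b0 = (0 : F) • b0 := hb0.1
  have h2 : b0 * a = (0 : F) • b0 := hb0.2
  rw [sub_eq_of_decomposition idem hb0 hbl hb]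
  constructor
  · simp only [mul_sub, mul_smul_comm, idem, h1]; module
  · simp only [sub_mul, smul_mul_assoc, idem, h2]; module

theorem sub_mem_plus_of_decomposition {l α : F} {a b b0 bl : A} (idem : a * a = a)
    (hb0 : b0 ∈ eig2 F A a 0 0) (hbl : bl ∈ eig2 F A a l l) (hb : b = α • a + b0 + bl) :
    a * b - l • a - l • b ∈ leftEig F A a 0 ⊔ leftEig F A a 1 := by
  rw [sub_eq_of_decomposition idem hb0 hbl hb, sub_eq_add_neg, add_comm]
  refine Submodule.add_mem_sup (neg_mem (Submodule.smul_mem _ _ hb0.1))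
    (Submodule.smul_mem _ _ ?_)
  change a * a = (1 : F) • a
  rw [idem, one_smul]

theorem LinearIndependent.eq_zero_of_triple {V : Type*} [AddCommGroup V] [Module F V]
    {a b s : V} (h : LinearIndependent F ![a, b, s])
    {x y z : F} (e : x • a + y • b + z • s = 0) : x = 0 ∧ y = 0 ∧ z = 0 := by
  have := Fintype.linearIndependent_iff.1 h ![x, y, z] (by simpa [Fin.sum_univ_three] using e)
  exact ⟨this 0, this 1, this 2⟩

/-- The square of `s = ab - l(a + b)` lies in the plus-part of `a`, so it has no component
along `b`. -/
theorem IsLeftAxis.coeff_sq_eq_zero {l α : F} {a b b0 bl s : A} (ha : IsLeftAxis F A l a)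
    (hb0 : b0 ∈ eig2 F A a 0 0) (hbl : bl ∈ eig2 F A a l l) (hb : b = α • a + b0 + bl)
    (hs : s = a * b - l • a - l • b) (hli : LinearIndependent F ![a, b, s])
    {x y z : F} (hsq : s * s = x • a + y • b + z • s) : y = 0 := by
  have hmem : s ∈ leftEig F A a 0 ⊔ leftEig F A a 1 :=
    hs ▸ sub_mem_plus_of_decomposition ha.idem hb0 hbl hb
  obtain ⟨v, hv, w, hw, hvw⟩ := Submodule.mem_sup.1 (ha.fusePP s hmem s hmem)
  rw [ha.prim] at hw
  obtain ⟨c, rfl⟩ := Submodule.mem_span_singleton.1 hw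
  have hv' : a * v = (0 : F) • v := hv
  have has := (mul_sub_of_decomposition ha.idem hb0 hbl hb).1
  rw [← hs] at has
  have hab : a * b = s + l • a + l • b := by rw [hs]; module
  have h1 : a * (s * s) = c • a := by
    rw [← hvw, mul_add, mul_smul_comm, hv', ha.idem]; module
  rw [hsq] at h1
  simp only [mul_add, mul_smul_comm, ha.idem, has, hab] at h1
  refine (hli.eq_zero_of_triple (x := x + y * l + z * (α * (1 - l) - l) - c)
    (y := y * l) (z := y) ?_).2.2
  rw [← sub_eq_zero] at h1
  rw [← h1]
  module

theorem IsLeftAxis.eigenvalue_eq {l α g z : F} {a b b0 bl s : A} (ha : IsLeftAxis F A l a)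
    (hb0 : b0 ∈ eig2 F A a 0 0) (hbl : bl ∈ eig2 F A a l l) (hb : b = α • a + b0 + bl)
    (hs : s = a * b - l • a - l • b) (hli : LinearIndependent F ![a, b, s])
    (hsq : s * s = z • s) (hsb : s * b = g • b) : g = z := by
  have hmem : s ∈ leftEig F A a 0 ⊔ leftEig F A a 1 :=
    hs ▸ sub_mem_plus_of_decomposition ha.idem hb0 hbl hb
  have h := ha.fusePM s hmem _ (Submodule.smul_mem _ l hbl.1)
  have hlbl : l • bl = s + (l - α) • a + l • b := by
    have := (mul_of_decomposition ha.idem hb0 hbl hb).1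
    rw [← sub_eq_iff_eq_add'.2 this, hs]
    module
  obtain ⟨has, hsa⟩ := mul_sub_of_decomposition ha.idem hb0 hbl hb
  rw [← hs] at has hsa
  have hab : a * b = s + l • a + l • b := by rw [hs]; module
  rw [hlbl] at h
  simp only [mul_add, mul_smul_comm, hsq, hsa, hsb] at h
  have h1 : a * (z • s + (l - α) • (α * (1 - l) - l) • a + l • g • b) =
    l • (z • s + (l - α) • (α * (1 - l) - l) • a + l • g • b) := h
  simp only [mul_add, mul_smul_comm, ha.idem, has, hab] at h1
  rw [← sub_eq_zero] at h1
  have := (hli.eq_zero_of_triple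
    (x := z * (α * (1 - l) - l) + (l - α) * (α * (1 - l) - l) + l * g * l
      - l * (l - α) * (α * (1 - l) - l))
    (y := 0) (z := l * (g - z)) (by rw [← h1]; module)).2.2
  exact sub_eq_zero.1 ((mul_eq_zero.1 this).resolve_left ha.l_ne_zero)

/-- If the span of two commuting idempotents contains their product, it is a subalgebra. -/
theorem span_pair_eq_top_of_mul_mem {a b : A} (haa : a * a = a) (hbb : b * b = b)
    (hba : b * a = a * b) (hab : a * b ∈ Submodule.span F {a, b})
    (hgen : NonUnitalAlgebra.adjoin F {a, b} = ⊤) : Submodule.span F {a, b} = ⊤ := by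
  have hasp : a ∈ Submodule.span F {a, b} := Submodule.subset_span (by simp)
  have hbsp : b ∈ Submodule.span F {a, b} := Submodule.subset_span (by simp)
  refine eq_top_iff.2 fun v _ => ?_
  have hv : v ∈ NonUnitalAlgebra.adjoin F {a, b} := hgen ▸ NonUnitalAlgebra.mem_top
  induction hv using NonUnitalAlgebra.adjoin_induction with
  | mem x hx => exact Submodule.subset_span hx
  | add x y _ _ hx hy => exact add_mem (hx trivial) (hy trivial)
  | zero => exact zero_mem _
  | smul r x _ hx => exact Submodule.smul_mem _ r (hx trivial)
  | mul x y _ _ hx hy =>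
    obtain ⟨p, q, rfl⟩ := Submodule.mem_span_pair.1 (hx trivial)
    obtain ⟨r, t, rfl⟩ := Submodule.mem_span_pair.1 (hy trivial)
    have : (p • a + q • b) * (r • a + t • b) =
        (p * r) • a + (q * t) • b + (p * t + q * r) • (a * b) := by
      simp only [mul_add, add_mul, smul_mul_assoc, mul_smul_comm, haa, hbb, hba]
      module
    rw [this]
    exact add_mem (add_mem (Submodule.smul_mem _ _ hasp) (Submodule.smul_mem _ _ hbsp))
      (Submodule.smul_mem _ _ hab)

theorem linearIndependent_of_adjoin_eq_top {l : F} {a b : A} (haa : a * a = a) (hbb : b * b = b)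
    (hba : b * a = a * b) (hgen : NonUnitalAlgebra.adjoin F {a, b} = ⊤)
    (hdim : Module.finrank F A = 3) :
    LinearIndependent F ![a, b, a * b - l • a - l • b] := by
  have hasp : a ∈ Submodule.span F {a, b} := Submodule.subset_span (by simp)
  have hbsp : b ∈ Submodule.span F {a, b} := Submodule.subset_span (by simp)
  have hnot : a * b ∉ Submodule.span F {a, b} := by
    intro hab
    have htop := span_pair_eq_top_of_mul_mem haa hbb hba hab hgen
    classical
    have h2 := finrank_span_finset_le_card (R := F) ({a, b} : Finset A)
    rw [Set.finrank, Finset.coe_pair, htop, finrank_top, hdim] at h2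
    have h3 := Finset.card_le_two (a := a) (b := b)
    lia
  rw [Fintype.linearIndependent_iff]
  intro g hg
  simp only [Fin.sum_univ_three, Matrix.cons_val_zero, Matrix.cons_val_one,
    Matrix.cons_val] at hg
  have h2 : g 2 = 0 := by
    by_contra h
    refine hnot (((Submodule.span F {a, b}).smul_mem_iff h).1 ?_)
    have : g 2 • (a * b) = (g 2 * l - g 0) • a + (g 2 * l - g 1) • b := by
      rw [← sub_eq_zero, ← hg]; module
    rw [this]
    exact add_mem (Submodule.smul_mem _ _ hasp) (Submodule.smul_mem _ _ hbsp)
  rw [h2, zero_smul, add_zero] at hg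
  have h0 : g 0 = 0 := by
    by_contra h
    refine hnot (((Submodule.span F {a, b}).smul_mem_iff h).1 ?_)
    have : g 0 • (a * b) = (-g 1) • b := by
      have := congrArg (· * b) hg
      simp only [add_mul, smul_mul_assoc, hbb, zero_mul] at this
      rw [← sub_eq_zero, ← this]; module
    rw [this]
    exact Submodule.smul_mem _ _ hbsp
  have h1 : g 1 = 0 := by
    rw [h0, zero_smul, zero_add] at hg
    refine (smul_eq_zero.1 hg).resolve_right fun hb => hnot ?_
    simp [hb]
  intro i
  fin_cases i <;> assumption

end Helpers

/-- in the commutative 3-dimensional case with `l = l'`, the coefficients of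
the decompositions coincide: `αa = αb`. -/
theorem comm_dim_three_alpha_eq (hchar : (2 : F) ≠ 0) (l l' : F) (a b : A)
    (ha : IsJordanAxis F A l l a) (hb : IsJordanAxis F A l' l' b)
    (hgen : NonUnitalAlgebra.adjoin F {a, b} = ⊤) (hdim : Module.finrank F A = 3)
    (hll : l = l')
    (αb αa : F) (b0 bll a0 al : A)
    (hb0 : b0 ∈ eig2 F A a 0 0) (hbll : bll ∈ eig2 F A a l l)
    (ha0 : a0 ∈ eig2 F A b 0 0) (hal : al ∈ eig2 F A b l' l')
    (hbdec : b = αb • a + b0 + bll) (hadec : a = αa • b + a0 + al) :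
    αa = αb := by
  subst hll
  have haa := ha.toLeft.idem
  have hbb := hb.toLeft.idem
  have hba : b * a = a * b := by
    have h := mul_of_decomposition haa hb0 hbll hbdec
    rw [h.1, h.2]
  have hli := linearIndependent_of_adjoin_eq_top (l := l) haa hbb hba hgen hdim
  have hli' := linearIndependent_of_adjoin_eq_top (l := l) hbb haa hba.symm
    (Set.pair_comm a b ▸ hgen) hdim
  have hsa := (mul_sub_of_decomposition haa hb0 hbll hbdec).2
  have hsb := (mul_sub_of_decomposition hbb ha0 hal hadec).2
  have hs : a * b - l • a - l • b = b * a - l • b - l • a := by rw [hba]; module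
  rw [← hs] at hli' hsb
  generalize hsdef : a * b - l • a - l • b = s at *
  obtain ⟨x, y, z, hsq⟩ : ∃ x y z : F, s * s = x • a + y • b + z • s := by
    have hspan := hli.span_eq_top_of_card_eq_finrank (by simp [hdim])
    obtain ⟨c, hc⟩ := (Submodule.mem_span_range_iff_exists_fun F).1
      (hspan ▸ Submodule.mem_top : s * s ∈ Submodule.span F (Set.range ![a, b, s]))
    exact ⟨c 0, c 1, c 2, by simpa [Fin.sum_univ_three] using hc.symm⟩
  have hy := ha.toLeft.coeff_sq_eq_zero hb0 hbll hbdec hsdef.symm hli hsq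
  have hx := hb.toLeft.coeff_sq_eq_zero ha0 hal hadec hs hli'
    (by rw [hsq, add_comm (x • a)])
  have hsz : s * s = z • s := by rw [hsq, hx, hy]; module
  have h1 := ha.toLeft.eigenvalue_eq hb0 hbll hbdec hsdef.symm hli hsz hsb
  have h2 := hb.toLeft.eigenvalue_eq ha0 hal hadec hs hli' hsz hsa
  have hl : 1 - l ≠ 0 := sub_ne_zero.2 ha.toLeft.l_ne_one.symm
  exact mul_right_cancel₀ hl (sub_left_inj.1 (h1.trans h2.symm))
end

section
/- Suppose A is generated by two axes a and b of Jordan type (λ,δ) and (λ',δ') respectively. Then A_0(L_a)·A_0(L_a) ⊆ A_0(L_a); that is, the 0-eigenspace of L_a is closed under multiplication. -/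
/-! Common definitions: eigenspaces of left/right multiplication, axes, Jordan axes,
in a not-necessarily-associative, not-necessarily-commutative, not-necessarily-unital
algebra `A` over a field `F`. -/

variable (F : Type*) [Field F]
variable (A : Type*) [NonUnitalNonAssocRing A] [Module F A]
  [SMulCommClass F A A] [IsScalarTower F A A]

section

variable {F A} {l d l' d' : F} {a b : A}

namespace IsJordanAxis

theorem mul_right_of_zero (ha : IsJordanAxis F A l d a) {x : A} (hx : a * x = 0) :
    x * a = 0 := by
  have h1 : a * (x * a) = 0 := by rw [ha.comm, hx, zero_mul]
  have h2 : a * (x * a * a) = 0 := by rw [ha.comm, h1, zero_mul]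
  have hz : x * a * a - x * a ∈ eig2 F A a 0 d := by
    refine ⟨?_, ?_⟩
    · change a * _ = (0 : F) • _
      rw [mul_sub, h1, h2, zero_smul, sub_zero]
    · change _ * a = d • _
      rw [sub_mul]
      linear_combination (norm := module) ha.toRight.cube x
  rw [ha.j_right, Submodule.mem_bot, sub_eq_zero] at hz
  have h3 : x * a ∈ rightEig F A a 1 := by
    change x * a * a = (1 : F) • _
    rw [hz, one_smul]
  rw [ha.toRight.prim, Submodule.mem_span_singleton] at h3
  obtain ⟨c, hc⟩ := h3
  rw [← hc, mul_smul_comm, ha.toLeft.idem, hc] at h1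
  exact h1

theorem mul_right_of_minus (ha : IsJordanAxis F A l d a) {y : A} (hy : a * y = l • y) :
    y * a = d • y := by
  have h1 : a * (y * a) = l • (y * a) := by rw [ha.comm, hy, smul_mul_assoc]
  have h2 : a * (y * a * a) = l • (y * a * a) := by rw [ha.comm, h1, smul_mul_assoc]
  have hz : y * a * a - y * a - d • (y * a) + d • y ∈ eig2 F A a l 0 := by
    refine ⟨?_, ?_⟩
    · change a * _ = l • _
      simp only [mul_sub, mul_add, mul_smul_comm, h1, h2, hy]
      module
    · change _ * a = (0 : F) • _
      simp only [sub_mul, add_mul, smul_mul_assoc]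
      rw [ha.toRight.cube y, zero_smul]
  rw [ha.j_left, Submodule.mem_bot] at hz
  have h3 : y * a - d • y ∈ rightEig F A a 1 := by
    change _ * a = (1 : F) • _
    rw [sub_mul, smul_mul_assoc]
    linear_combination (norm := module) hz
  rw [ha.toRight.prim, Submodule.mem_span_singleton] at h3
  obtain ⟨c, hc⟩ := h3
  have h4 : c • a = l • (c • a) := by
    have h5 : a * (c • a) = l • (c • a) := by
      rw [hc, mul_sub, mul_smul_comm, h1, hy]
      module
    rwa [mul_smul_comm, ha.toLeft.idem] at h5
  have h6 : (1 - l) • (c • a) = 0 := by linear_combination (norm := module) h4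
  rcases smul_eq_zero.mp h6 with h | h
  · exact absurd (sub_eq_zero.mp h).symm ha.toLeft.l_ne_one
  · rw [hc] at h
    exact sub_eq_zero.mp h

theorem mem_plus_iff (ha : IsJordanAxis F A l d a) {v : A} :
    v ∈ leftEig F A a 0 ⊔ leftEig F A a 1 ↔ ∃ (c : F) (x : A), a * x = 0 ∧ v = c • a + x := by
  rw [ha.toLeft.prim, Submodule.mem_sup]
  constructor
  · rintro ⟨x, hx, y, hy, rfl⟩
    obtain ⟨c, rfl⟩ := Submodule.mem_span_singleton.mp hy
    have hx' : a * x = (0 : F) • x := hx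
    exact ⟨c, x, by rw [hx', zero_smul], add_comm _ _⟩
  · rintro ⟨c, x, hx, rfl⟩
    refine ⟨x, ?_, c • a, Submodule.mem_span_singleton.mpr ⟨c, rfl⟩, add_comm _ _⟩
    change a * x = (0 : F) • x
    rw [hx, zero_smul]

theorem exists_decomp (ha : IsJordanAxis F A l d a) (v : A) :
    ∃ (c : F) (x y : A), a * x = 0 ∧ a * y = l • y ∧ v = c • a + x + y := by
  have hv : v ∈ leftEig F A a 0 ⊔ leftEig F A a 1 ⊔ leftEig F A a l := by
    rw [ha.toLeft.decomp]; trivial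
  obtain ⟨p, hp, y, hy, rfl⟩ := Submodule.mem_sup.mp hv
  obtain ⟨c, x, hx, rfl⟩ := ha.mem_plus_iff.mp hp
  exact ⟨c, x, y, hx, hy, rfl⟩

theorem decomp_eq_zero (ha : IsJordanAxis F A l d a) {c : F} {x y : A} (hx : a * x = 0)
    (hy : a * y = l • y) (h : c • a + x + y = 0) : c • a = 0 ∧ x = 0 ∧ y = 0 := by
  have h1 : c • a + l • y = 0 := by
    have := congrArg (a * ·) h
    simpa only [mul_add, mul_smul_comm, ha.toLeft.idem, hx, hy, add_zero, mul_zero] using this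
  have h2 : c • a + l • l • y = 0 := by
    have := congrArg (a * ·) h1
    simpa only [mul_add, mul_smul_comm, ha.toLeft.idem, hy, mul_zero] using this
  have h3 : (l * (1 - l)) • y = 0 := by linear_combination (norm := module) h1 - h2
  have hl : l * (1 - l) ≠ 0 :=
    mul_ne_zero ha.toLeft.l_ne_zero (sub_ne_zero.mpr ha.toLeft.l_ne_one.symm)
  have hy0 : y = 0 := (smul_eq_zero.mp h3).resolve_left hl
  have hc : c • a = 0 := by simpa [hy0] using h1
  exact ⟨hc, by simpa [hy0, hc] using h, hy0⟩

theorem mul_zero_zero (ha : IsJordanAxis F A l d a) {x y : A} (hx : a * x = 0)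
    (hy : a * y = 0) : ∃ (c : F) (z : A), a * z = 0 ∧ x * y = c • a + z :=
  ha.mem_plus_iff.mp <| ha.toLeft.fusePP x (ha.mem_plus_iff.mpr ⟨0, x, hx, by simp⟩) y
    (ha.mem_plus_iff.mpr ⟨0, y, hy, by simp⟩)

theorem mul_minus_minus (ha : IsJordanAxis F A l d a) {x y : A} (hx : a * x = l • x)
    (hy : a * y = l • y) : ∃ (c : F) (z : A), a * z = 0 ∧ x * y = c • a + z :=
  ha.mem_plus_iff.mp <| ha.toLeft.fuseMM x hx y hy

theorem mul_zero_minus (ha : IsJordanAxis F A l d a) {x y : A} (hx : a * x = 0)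
    (hy : a * y = l • y) : a * (x * y) = l • (x * y) :=
  ha.toLeft.fusePM x (ha.mem_plus_iff.mpr ⟨0, x, hx, by simp⟩) y hy

theorem mul_minus_zero (ha : IsJordanAxis F A l d a) {x y : A} (hx : a * x = 0)
    (hy : a * y = l • y) : a * (y * x) = l • (y * x) :=
  ha.toLeft.fuseMP y hy x (ha.mem_plus_iff.mpr ⟨0, x, hx, by simp⟩)

/-- Comparison of plus and minus parts of an equation. -/
theorem parts_eq (ha : IsJordanAxis F A l d a) {c c' : F} {x x' y y' : A} (hx : a * x = 0)
    (hx' : a * x' = 0) (hy : a * y = l • y) (hy' : a * y' = l • y')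
    (h : c • a + x + y = c' • a + x' + y') : c • a = c' • a ∧ x = x' ∧ y = y' := by
  have h0 : (c - c') • a + (x - x') + (y - y') = 0 := by linear_combination (norm := module) h
  obtain ⟨h1, h2, h3⟩ := ha.decomp_eq_zero (by rw [mul_sub, hx, hx', sub_zero])
    (by rw [mul_sub, hy, hy', smul_sub]) h0
  exact ⟨sub_eq_zero.mp (by rw [← sub_smul]; exact h1), sub_eq_zero.mp h2, sub_eq_zero.mp h3⟩

/-- The plus and minus parts of the equation `e * e = e`. -/
theorem idem_parts (ha : IsJordanAxis F A l d a) {e x u : A} {c : F} (he : e * e = e)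
    (hx : a * x = 0) (hu : a * u = l • u) (h : e = c • a + x + u) :
    x * x + u * u = (c - c ^ 2) • a + x ∧ x * u + u * x = (1 - c * (l + d)) • u := by
  have hxr := ha.mul_right_of_zero hx
  have hur := ha.mul_right_of_minus hu
  obtain ⟨s, z, hz, hs⟩ := ha.mul_zero_zero hx hx
  obtain ⟨t, w, hw, ht⟩ := ha.mul_minus_minus hu hu
  have e1 : e * e = (c ^ 2) • a + (x * x + u * u) + (c * (l + d)) • u + (x * u + u * x) := by
    rw [h]
    simp only [mul_add, add_mul, mul_smul_comm, smul_mul_assoc, ha.toLeft.idem, hx, hu, hxr, hur]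
    module
  rw [he, hs, ht, h] at e1
  have e2 : (c ^ 2 + s + t) • a + (z + w) + ((c * (l + d)) • u + (x * u + u * x))
      = c • a + x + u := by linear_combination (norm := module) -e1
  obtain ⟨h1, h2, h3⟩ := ha.parts_eq (by rw [mul_add, hz, hw, add_zero]) hx
    (by simp only [mul_add, mul_smul_comm, hu, ha.mul_zero_minus hx hu, ha.mul_minus_zero hx hu]
        module) hu e2
  refine ⟨?_, ?_⟩
  · rw [hs, ht]
    linear_combination (norm := module) h1 + h2
  · linear_combination (norm := module) h3

/-- Plus and minus parts of `b * u` and `u * b`, where `u` is the minus part of `b`, in the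
commutative situation. -/
theorem minus_mul_self (ha : IsJordanAxis F A l l a) (hb : IsJordanAxis F A l' l' b)
    {α β : F} {x u y w : A} (hx : a * x = 0) (hu : a * u = l • u) (h : b = α • a + x + u)
    (hy : b * y = 0) (hw : b * w = l' • w) (h' : a = β • b + y + w) :
    l • (u * u) = ((l' - α) * α) • a + (β * (1 - l')) • (α • a + x) ∧
      (2 * ((l' - α) * l + β * (1 - l'))) • u = l • u := by
  have hxr := ha.mul_right_of_zero hx
  have hur := ha.mul_right_of_minus hu
  have hyr := hb.mul_right_of_zero hy
  have hwr := hb.mul_right_of_minus hw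
  have hab : a * b = α • a + l • u := by
    rw [h, mul_add, mul_add, mul_smul_comm, ha.toLeft.idem, hx, hu, add_zero]
  have hba : b * a = α • a + l • u := by
    rw [h, add_mul, add_mul, smul_mul_assoc, ha.toLeft.idem, hxr, hur, add_zero]
  have hab' : a * b = β • b + l' • w := by
    conv_lhs => rw [h']
    rw [add_mul, add_mul, smul_mul_assoc, hb.toLeft.idem, hyr, hwr, add_zero]
  have hlw : l' • w = α • a + l • u - β • b := by rw [← hab, hab']; module
  have hlu : l • u = β • b + l' • w - α • a := by rw [hlw]; module
  have hbu : l • (b * u) = (l' - α) • (α • a + l • u) + (β * (1 - l')) • b := by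
    rw [← mul_smul_comm, hlu, mul_sub, mul_add, mul_smul_comm, mul_smul_comm, mul_smul_comm,
      hb.toLeft.idem, hw, hba, hlw]
    module
  have hub : l • (u * b) = (l' - α) • (α • a + l • u) + (β * (1 - l')) • b := by
    rw [← smul_mul_assoc, hlu, sub_mul, add_mul, smul_mul_assoc, smul_mul_assoc, smul_mul_assoc,
      hb.toLeft.idem, hwr, hab, hlw]
    module
  obtain ⟨t, z, hz, ht⟩ := ha.mul_minus_minus hu hu
  have hxu := ha.mul_zero_minus hx hu
  have hux := ha.mul_minus_zero hx hu
  have e1 : b * u = (α * l) • u + x * u + (t • a + z) := by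
    conv_lhs => rw [h]
    rw [add_mul, add_mul, smul_mul_assoc, hu, ht, smul_smul]
  have e2 : u * b = (α * l) • u + u * x + (t • a + z) := by
    conv_lhs => rw [h]
    rw [mul_add, mul_add, mul_smul_comm, hur, ht, smul_smul]
  have hxuux := (ha.idem_parts hb.toLeft.idem hx hu h).2
  have p1 : (l * t) • a + l • z + (l • ((α * l) • u + x * u)) =
      ((l' - α) * α + β * (1 - l') * α) • a + (β * (1 - l')) • x +
        ((l' - α) * l + β * (1 - l')) • u := by
    have := hbu
    rw [e1] at this
    rw [h] at this
    linear_combination (norm := module) this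
  have p2 : (l * t) • a + l • z + (l • ((α * l) • u + u * x)) =
      ((l' - α) * α + β * (1 - l') * α) • a + (β * (1 - l')) • x +
        ((l' - α) * l + β * (1 - l')) • u := by
    have := hub
    rw [e2] at this
    rw [h] at this
    linear_combination (norm := module) this
  obtain ⟨q1, q2, q3⟩ := ha.parts_eq (by rw [mul_smul_comm, hz, smul_zero])
    (by rw [mul_smul_comm, hx, smul_zero])
    (by simp only [mul_add, mul_smul_comm, hu, hxu]; module)
    (by simp only [mul_smul_comm, hu]; module) p1
  obtain ⟨-, -, r3⟩ := ha.parts_eq (by rw [mul_smul_comm, hz, smul_zero])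
    (by rw [mul_smul_comm, hx, smul_zero])
    (by simp only [mul_add, mul_smul_comm, hu, hux]; module)
    (by simp only [mul_smul_comm, hu]; module) p2
  refine ⟨?_, ?_⟩
  · rw [ht]
    linear_combination (norm := module) q1 + q2
  · linear_combination (norm := module) -q3 - r3 + l • hxuux

theorem coeff_eq_zero (ha : IsJordanAxis F A l d a) (ha0 : a ≠ 0) {x u : A} (hx : a * x = 0)
    (hu : a * u = l • u) (hx0 : x ≠ 0) (hu0 : u ≠ 0) {r s t : F}
    (h : r • a + s • x + t • u = 0) : r = 0 ∧ s = 0 ∧ t = 0 := by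
  obtain ⟨h1, h2, h3⟩ := ha.decomp_eq_zero (by rw [mul_smul_comm, hx, smul_zero])
    (by rw [mul_smul_comm, hu, smul_comm]) h
  exact ⟨(smul_eq_zero.mp h1).resolve_right ha0, (smul_eq_zero.mp h2).resolve_right hx0,
    (smul_eq_zero.mp h3).resolve_right hu0⟩

/-- The square of the zero part of `b` is a zero vector for `a`, commutative situation. -/
theorem zero_part_sq_of_comm (hchar : (2 : F) ≠ 0) (ha : IsJordanAxis F A l l a)
    (hb : IsJordanAxis F A l' l' b) (ha0 : a ≠ 0)
    {α β : F} {x u y w : A} (hx : a * x = 0) (hu : a * u = l • u) (h : b = α • a + x + u)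
    (hx0 : x ≠ 0) (hu0 : u ≠ 0)
    (hy : b * y = 0) (hw : b * w = l' • w) (h' : a = β • b + y + w) :
    a * (x * x) = 0 := by
  have hl := ha.toLeft.l_ne_zero
  obtain ⟨m1, m2⟩ := ha.minus_mul_self hb hx hu h hy hw h'
  obtain ⟨m1', -⟩ := hb.minus_mul_self ha hy hw h' hx hu h
  have hsq := (ha.idem_parts hb.toLeft.idem hx hu h).1
  have hur := ha.mul_right_of_minus hu
  have hwr := hb.mul_right_of_minus hw
  have E1 : 2 * ((l' - α) * l + β * (1 - l')) = l := by
    have : (2 * ((l' - α) * l + β * (1 - l')) - l) • u = 0 := by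
      linear_combination (norm := module) m2
    exact sub_eq_zero.mp ((smul_eq_zero.mp this).resolve_right hu0)
  have hp : α • a + l • u = β • b + l' • w := by
    have h1 : a * b = α • a + l • u := by
      rw [h, mul_add, mul_add, mul_smul_comm, ha.toLeft.idem, hx, hu, add_zero]
    have h2 : a * b = β • b + l' • w := by
      conv_lhs => rw [h']
      rw [add_mul, add_mul, smul_mul_assoc, hb.toLeft.idem, hb.mul_right_of_zero hy, hwr,
        add_zero]
    rw [← h1, h2]
  have hP : (α • a + l • u) * (α • a + l • u) =
      (α ^ 2) • a + (2 * α * l ^ 2) • u + l • l • (u * u) := by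
    simp only [mul_add, add_mul, mul_smul_comm, smul_mul_assoc, ha.toLeft.idem, hu, hur]
    module
  have hP' : (α • a + l • u) * (α • a + l • u) =
      (β ^ 2) • b + (2 * β * l') • l' • w + l' • l' • (w * w) := by
    rw [hp]
    simp only [mul_add, add_mul, mul_smul_comm, smul_mul_assoc, hb.toLeft.idem, hw, hwr]
    module
  have hlw : l' • w = α • a + l • u - β • (α • a + x + u) := by
    rw [← h, hp]; module
  have hy' : β • b + y = a - w := by rw [eq_sub_iff_add_eq]; exact h'.symm
  rw [hP, m1, m1', hy'] at hP'
  have key : (α ^ 2) • a + (2 * α * l ^ 2) • u +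
      l • (((l' - α) * α) • a + (β * (1 - l')) • (α • a + x)) =
      (β ^ 2) • (α • a + x + u) + (2 * β * l') • (α • a + l • u - β • (α • a + x + u)) +
      ((l' * (l - β) * β) • (α • a + x + u) + (α * (1 - l)) • (l' • a -
        (α • a + l • u - β • (α • a + x + u)))) := by
    rw [← hlw, ← h, hP']
    module
  obtain ⟨k1, k2, k3⟩ := ha.coeff_eq_zero ha0 hx hu hx0 hu0
    (r := α ^ 2 + l * ((l' - α) * α) + l * β * (1 - l') * α - (β ^ 2 * α +
      2 * β * l' * (α - β * α) + l' * (l - β) * β * α + α * (1 - l) * (l' - α + β * α)))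
    (s := l * (β * (1 - l')) - (β ^ 2 - 2 * β * l' * β + l' * (l - β) * β + α * (1 - l) * β))
    (t := 2 * α * l ^ 2 - (β ^ 2 + 2 * β * l' * (l - β) + l' * (l - β) * β
      + α * (1 - l) * (β - l)))
    (by linear_combination (norm := module) key)
  have hν : 2 * l * (l * (α - α ^ 2) - (l' - α) * α - β * (1 - l') * α) = 0 := by
    linear_combination 2 * l * k1 - 2 * l * α * k2 - 2 * α * (k3 - k2) - 2 * l * α * E1
  have hν' : l * (α - α ^ 2) - (l' - α) * α - β * (1 - l') * α = 0 :=
    (mul_eq_zero.mp hν).resolve_left (mul_ne_zero hchar hl)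
  have hxx : l • (x * x) = (l - β * (1 - l')) • x := by
    have : l • (x * x) = (l * (α - α ^ 2) - (l' - α) * α - β * (1 - l') * α) • a +
        (l - β * (1 - l')) • x := by
      linear_combination (norm := module) l • hsq - m1
    rwa [hν', zero_smul, zero_add] at this
  have : l • (a * (x * x)) = 0 := by
    rw [← mul_smul_comm, hxx, mul_smul_comm, hx, smul_zero]
  exact (smul_eq_zero.mp this).resolve_left hl

/-- The square of the zero part of `b` is a zero vector for `a`. -/
theorem zero_part_sq (hchar : (2 : F) ≠ 0) (ha : IsJordanAxis F A l d a)
    (hb : IsJordanAxis F A l' d' b) {α : F} {x u : A} (hx : a * x = 0) (hu : a * u = l • u)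
    (h : b = α • a + x + u) : a * (x * x) = 0 := by
  by_cases ha0 : a = 0
  · rw [ha0, zero_mul]
  by_cases hx0 : x = 0
  · rw [hx0, mul_zero, mul_zero]
  have hxr := ha.mul_right_of_zero hx
  have hur := ha.mul_right_of_minus hu
  obtain ⟨hsq, -⟩ := ha.idem_parts hb.toLeft.idem hx hu h
  obtain ⟨β, y, w, hy, hw, h'⟩ := hb.exists_decomp a
  have hyr := hb.mul_right_of_zero hy
  have hwr := hb.mul_right_of_minus hw
  have hab : a * b = α • a + l • u := by
    rw [h, mul_add, mul_add, mul_smul_comm, ha.toLeft.idem, hx, hu, add_zero]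
  have hba : b * a = α • a + d • u := by
    rw [h, add_mul, add_mul, smul_mul_assoc, ha.toLeft.idem, hxr, hur, add_zero]
  have hab' : a * b = β • b + d' • w := by
    conv_lhs => rw [h']
    rw [add_mul, add_mul, smul_mul_assoc, hb.toLeft.idem, hyr, hwr, add_zero]
  have hba' : b * a = β • b + l' • w := by
    conv_lhs => rw [h']
    rw [mul_add, mul_add, mul_smul_comm, hb.toLeft.idem, hy, hw, add_zero]
  by_cases hu0 : u = 0
  · rw [hu0, mul_zero, add_zero] at hsq
    have hα : (α - α ^ 2) • a = 0 := by
      rw [hu0, smul_zero, add_zero] at hba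
      have e : (β - α * β) • b + (-α) • y + (l' - α) • w = 0 := by
        have : β • b + l' • w = α • (β • b + y + w) := by rw [← h', ← hba', hba]
        linear_combination (norm := module) this
      obtain ⟨e1, e2, e3⟩ := hb.decomp_eq_zero (by rw [mul_smul_comm, hy, smul_zero])
        (by rw [mul_smul_comm, hw, smul_comm]) e
      by_cases hα0 : α = 0
      · simp [hα0]
      by_cases hα1 : α = 1
      · simp [hα1]
      exfalso
      have hy0 : y = 0 := (smul_eq_zero.mp e2).resolve_left (neg_ne_zero.mpr hα0)
      have hβ : β • b = 0 := by
        have : (1 - α) • (β • b) = 0 := by linear_combination (norm := module) e1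
        exact (smul_eq_zero.mp this).resolve_left (sub_ne_zero.mpr (Ne.symm hα1))
      have haw : a = w := by rw [hy0, hβ] at h'; simpa using h'
      obtain ⟨c, z, hz, hc⟩ := hb.mul_minus_minus hw hw
      rw [← haw, ha.toLeft.idem, haw] at hc
      have := hb.decomp_eq_zero (c := c) (x := z) (y := -w) hz (by rw [mul_neg, hw, smul_neg])
        (by rw [← hc]; simp)
      exact ha0 (by rw [haw]; exact neg_eq_zero.mp this.2.2)
    rw [hsq, hα, zero_add, hx]
  have hwu : (l' - d') • w = (d - l) • u := by
    linear_combination (norm := module) hab' - hba' - hab + hba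
  by_cases hl : l = d
  · subst hl
    by_cases hl' : l' = d'
    · subst hl'
      exact zero_part_sq_of_comm hchar ha hb ha0 hx hu h hx0 hu0 hy hw h'
    · exfalso
      rw [sub_self, zero_smul] at hwu
      have hw0 := (smul_eq_zero.mp hwu).resolve_left (sub_ne_zero.mpr hl')
      have e : α • a + l • u = β • (α • a + x + u) := by
        rw [← h, ← hab, hab', hw0]; simp
      obtain ⟨-, e2, e3⟩ := ha.coeff_eq_zero ha0 hx hu hx0 hu0 (r := α - β * α) (s := -β)
        (t := l - β) (by linear_combination (norm := module) e)
      exact ha.toLeft.l_ne_zero (by linear_combination e3 - e2)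
  · have hud : u = ((d - l)⁻¹ * (l' - d')) • w := by
      rw [mul_smul, hwu, inv_smul_smul₀ (sub_ne_zero.mpr (Ne.symm hl))]
    have hl' : l' - d' ≠ 0 := by
      intro h0
      exact hu0 (by rw [hud, h0, mul_zero, zero_smul])
    have hwd : w = ((l' - d')⁻¹ * (d - l)) • u := by
      rw [mul_smul, ← hwu, inv_smul_smul₀ hl']
    have hbu : b * u = l' • u := by
      rw [hud, mul_smul_comm, hw, smul_comm]
    have e : α • a + l • u =
        β • (α • a + x + u) + d' • ((l' - d')⁻¹ * (d - l)) • u := by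
      rw [← h, ← hwd, ← hab, hab']
    obtain ⟨e1, e2, -⟩ := ha.coeff_eq_zero ha0 hx hu hx0 hu0 (r := α - β * α) (s := -β)
      (t := l - β - d' * ((l' - d')⁻¹ * (d - l))) (by linear_combination (norm := module) e)
    have hα : α = 0 := by linear_combination e1 - α * e2
    obtain ⟨t, z, hz, ht⟩ := ha.mul_minus_minus hu hu
    have e3 : t • a + z + (x * u - l' • u) = 0 := by
      rw [← ht, ← hbu]
      conv_lhs => rw [h, hα]
      rw [zero_smul, zero_add, add_mul]
      abel
    obtain ⟨f1, f2, -⟩ := ha.decomp_eq_zero hz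
      (by rw [mul_sub, mul_smul_comm, hu, ha.mul_zero_minus hx hu]; module) e3
    rw [ht, f1, f2, hα] at hsq
    have : x * x = x := by simpa using hsq
    rw [this, hx]

/-- Two Jordan axes `a`, `b` generate the span of `a`, `b` and `a * b`. -/
theorem span_eq_top (ha : IsJordanAxis F A l d a) (hb : IsJordanAxis F A l' d' b)
    (hgen : NonUnitalAlgebra.adjoin F {a, b} = ⊤) :
    Submodule.span F {a, b, a * b} = ⊤ := by
  obtain ⟨α, x, u, hx, hu, h⟩ := ha.exists_decomp b
  obtain ⟨β, y, w, hy, hw, h'⟩ := hb.exists_decomp a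
  have hxr := ha.mul_right_of_zero hx
  have hur := ha.mul_right_of_minus hu
  have hyr := hb.mul_right_of_zero hy
  have hwr := hb.mul_right_of_minus hw
  have hab : a * b = α • a + l • u := by
    rw [h, mul_add, mul_add, mul_smul_comm, ha.toLeft.idem, hx, hu, add_zero]
  have hba : b * a = α • a + d • u := by
    rw [h, add_mul, add_mul, smul_mul_assoc, ha.toLeft.idem, hxr, hur, add_zero]
  have hab' : a * b = β • b + d' • w := by
    conv_lhs => rw [h']
    rw [add_mul, add_mul, smul_mul_assoc, hb.toLeft.idem, hyr, hwr, add_zero]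
  set W : Submodule F A := Submodule.span F {a, b, a * b}
  have haW : a ∈ W := Submodule.subset_span (by simp)
  have hbW : b ∈ W := Submodule.subset_span (by simp)
  have habW : a * b ∈ W := Submodule.subset_span (by simp)
  have huW : u ∈ W := by
    have : l • u ∈ W := by
      rw [show l • u = a * b - α • a by rw [hab]; abel]
      exact W.sub_mem habW (W.smul_mem _ haW)
    exact (W.smul_mem_iff ha.toLeft.l_ne_zero).mp this
  have hwW : w ∈ W := by
    have : d' • w ∈ W := by
      rw [show d' • w = a * b - β • b by rw [hab']; abel]
      exact W.sub_mem habW (W.smul_mem _ hbW)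
    exact (W.smul_mem_iff hb.toRight.d_ne_zero).mp this
  have hbaW : b * a ∈ W := by
    rw [hba]; exact W.add_mem (W.smul_mem _ haW) (W.smul_mem _ huW)
  have hapW : a * (a * b) ∈ W := by
    rw [hab, mul_add, mul_smul_comm, mul_smul_comm, ha.toLeft.idem, hu]
    exact W.add_mem (W.smul_mem _ haW) (W.smul_mem _ (W.smul_mem _ huW))
  have hpaW : a * b * a ∈ W := by
    rw [hab, add_mul, smul_mul_assoc, smul_mul_assoc, ha.toLeft.idem, hur]
    exact W.add_mem (W.smul_mem _ haW) (W.smul_mem _ (W.smul_mem _ huW))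
  have hbpW : b * (a * b) ∈ W := by
    rw [hab', mul_add, mul_smul_comm, mul_smul_comm, hb.toLeft.idem, hw]
    exact W.add_mem (W.smul_mem _ hbW) (W.smul_mem _ (W.smul_mem _ hwW))
  have hpbW : a * b * b ∈ W := by
    rw [hab', add_mul, smul_mul_assoc, smul_mul_assoc, hb.toLeft.idem, hwr]
    exact W.add_mem (W.smul_mem _ hbW) (W.smul_mem _ (W.smul_mem _ hwW))
  have haW' : ∀ v ∈ W, a * v ∈ W := by
    intro v hv
    induction hv using Submodule.span_induction with
    | mem v hv =>
      rcases hv with rfl | rfl | rfl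
      · rwa [ha.toLeft.idem]
      · exact habW
      · exact hapW
    | zero => simp
    | add v v' _ _ hv hv' => rw [mul_add]; exact W.add_mem hv hv'
    | smul c v _ hv => rw [mul_smul_comm]; exact W.smul_mem _ hv
  have hbu : b * u ∈ W := by
    have : l • (b * u) ∈ W := by
      rw [show l • (b * u) = b * (a * b) - α • (b * a) by
        rw [hab, mul_add, mul_smul_comm, mul_smul_comm]; abel]
      exact W.sub_mem hbpW (W.smul_mem _ hbaW)
    exact (W.smul_mem_iff ha.toLeft.l_ne_zero).mp this
  have huu : u * u ∈ W := by
    obtain ⟨t, z, hz, ht⟩ := ha.mul_minus_minus hu hu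
    have e : b * u = (α * l) • u + x * u + u * u := by
      conv_lhs => rw [h]
      rw [add_mul, add_mul, smul_mul_assoc, hu, smul_smul]
    have hxuW : l • (x * u) ∈ W := by
      have : l • (x * u) = a * (b * u) - (α * l * l) • u - t • a := by
        rw [e, ht]
        simp only [mul_add, mul_smul_comm, hu, hz, ha.toLeft.idem, ha.mul_zero_minus hx hu]
        module
      rw [this]
      exact W.sub_mem (W.sub_mem (haW' _ hbu) (W.smul_mem _ huW)) (W.smul_mem _ haW)
    rw [show u * u = b * u - (α * l) • u - x * u by rw [e]; abel]
    exact W.sub_mem (W.sub_mem hbu (W.smul_mem _ huW))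
      ((W.smul_mem_iff ha.toLeft.l_ne_zero).mp hxuW)
  have hppW : a * b * (a * b) ∈ W := by
    rw [hab]
    simp only [mul_add, add_mul, mul_smul_comm, smul_mul_assoc, ha.toLeft.idem, hu, hur]
    repeat' first | assumption | apply W.smul_mem | apply W.add_mem
  have hmul : ∀ v ∈ W, ∀ v' ∈ W, v * v' ∈ W := by
    intro v hv v' hv'
    induction hv, hv' using Submodule.span_induction₂ with
    | mem_mem v v' hv hv' =>
      rcases hv with rfl | rfl | rfl <;> rcases hv' with rfl | rfl | rfl <;>
        first
        | assumption
        | (rw [ha.toLeft.idem]; assumption)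
        | (rw [hb.toLeft.idem]; assumption)
    | zero_left => simp
    | zero_right => simp
    | add_left v v' v'' _ _ _ h1 h2 => rw [add_mul]; exact W.add_mem h1 h2
    | add_right v v' v'' _ _ _ h1 h2 => rw [mul_add]; exact W.add_mem h1 h2
    | smul_left c v v' _ _ h1 => rw [smul_mul_assoc]; exact W.smul_mem _ h1
    | smul_right c v v' _ _ h1 => rw [mul_smul_comm]; exact W.smul_mem _ h1
  rw [eq_top_iff]
  intro v _
  have hv : v ∈ NonUnitalAlgebra.adjoin F {a, b} := by rw [hgen]; trivial
  induction hv using NonUnitalAlgebra.adjoin_induction with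
  | mem v hv => rcases hv with rfl | rfl <;> assumption
  | add v v' _ _ h1 h2 => exact W.add_mem (h1 trivial) (h2 trivial)
  | zero => exact W.zero_mem
  | mul v v' _ _ h1 h2 => exact hmul _ (h1 trivial) _ (h2 trivial)
  | smul c v _ h1 => exact W.smul_mem _ (h1 trivial)

end IsJordanAxis

end

/-- if `A` is generated by two Jordan axes `a, b`, then
`A_0(L_a) · A_0(L_a) ⊆ A_0(L_a)`. -/
theorem zero_eigenspace_closed (hchar : (2 : F) ≠ 0) (l d l' d' : F) (a b : A)
    (ha : IsJordanAxis F A l d a) (hb : IsJordanAxis F A l' d' b)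
    (hgen : NonUnitalAlgebra.adjoin F {a, b} = ⊤) :
    ∀ x ∈ leftEig F A a 0, ∀ y ∈ leftEig F A a 0, x * y ∈ leftEig F A a 0 := by
  obtain ⟨α, x, u, hx, hu, h⟩ := ha.exists_decomp b
  have hab : a * b = α • a + l • u := by
    rw [h, mul_add, mul_add, mul_smul_comm, ha.toLeft.idem, hx, hu, add_zero]
  have hspan : ∀ v ∈ leftEig F A a 0, ∃ c : F, v = c • x := by
    intro v hv
    have hv0 : a * v = 0 := by
      have : a * v = (0 : F) • v := hv
      rwa [zero_smul] at this
    have hvW : v ∈ Submodule.span F {a, b, a * b} := by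
      rw [ha.span_eq_top hb hgen]; trivial
    obtain ⟨r, v', hv', rfl⟩ := Submodule.mem_span_insert.mp hvW
    obtain ⟨s, t, rfl⟩ := Submodule.mem_span_pair.mp hv'
    refine ⟨s, ?_⟩
    refine (ha.parts_eq (c := 0) (c' := r + s * α + t * α) (y := 0) (y' := (s + t * l) • u)
      hv0 (by rw [mul_smul_comm, hx, smul_zero]) (by simp)
      (by rw [mul_smul_comm, hu, smul_comm]) ?_).2.1
    rw [hab]
    nth_rewrite 1 [h]
    module
  intro v hv v' hv'
  obtain ⟨c, rfl⟩ := hspan v hv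
  obtain ⟨c', rfl⟩ := hspan v' hv'
  change a * _ = (0 : F) • _
  rw [smul_mul_assoc, mul_smul_comm, mul_smul_comm, mul_smul_comm,
    ha.zero_part_sq hchar hb hx hu h]
  simp
end
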